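/- arXiv:2005.10764 — 3 statements merged into one kernel-verified Lean document; each statement's English description precedes it below -/
import Mathlib

section
/- Let (A, m) be a commutative noetherian local ring, let M be a cohomologically bounded-below complex of A-modules all of whose cohomology modules are finitely generated, and let p ⊆ m be a prime ideal with dim(A/p) = 1. If Ext^n_A(A/p, M) ≠ 0 for some integer n, then Ext^{n+1}_A(A/m, M) ≠ 0. -/
open CategoryTheory Limits

/-- A chain map from a projective object in degree `0` that vanishes on `H⁰` factors through the
differential. -/
lemma HomologicalComplex.exists_comp_d_eq_of_homologyMap_eq_zero {C : Type*} [Category* C]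
    [Abelian C] {P : C} [Projective P] {K : CochainComplex C ℤ}
    (g : (HomologicalComplex.single C (.up ℤ) 0).obj P ⟶ K)
    (hg : HomologicalComplex.homologyMap g 0 = 0) :
    ∃ z : P ⟶ K.X (-1), z ≫ K.d (-1) 0 =
      (HomologicalComplex.singleObjXSelf (.up ℤ) 0 P).inv ≫ g.f 0 := by
  let k : P ⟶ K.cycles 0 :=
    (HomologicalComplex.singleObjCyclesSelfIso (.up ℤ) 0 P).inv ≫
      HomologicalComplex.cyclesMap g 0
  have hk : k ≫ K.homologyπ 0 = 0 := by
    rw [Category.assoc, ← HomologicalComplex.homologyπ_naturality, hg, comp_zero, comp_zero]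
  have hS : (ShortComplex.mk (K.toCycles (-1) 0) (K.homologyπ 0) (by simp)).Exact :=
    ShortComplex.exact_of_g_is_cokernel _ (K.homologyIsCokernel (-1) 0 (by simp))
  refine ⟨hS.liftFromProjective k hk, ?_⟩
  have h1 : hS.liftFromProjective k hk ≫ K.toCycles (-1) 0 = k := hS.liftFromProjective_comp k hk
  rw [← K.toCycles_i (-1) 0, reassoc_of% h1, Category.assoc, HomologicalComplex.cyclesMap_i,
    HomologicalComplex.singleObjCyclesSelfIso_inv_iCycles_assoc]

open CochainComplex HomComplex in
/-- A chain map from a projective object in degree `0` that vanishes on `H⁰` is null-homotopic. -/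
lemma CochainComplex.nonempty_homotopy_zero_of_homologyMap_eq_zero {C : Type*} [Category* C]
    [Abelian C] {P : C} [Projective P] {K : CochainComplex C ℤ}
    (g : (CochainComplex.singleFunctor C 0).obj P ⟶ K)
    (hg : HomologicalComplex.homologyMap g 0 = 0) : Nonempty (Homotopy g 0) := by
  obtain ⟨z, hz⟩ := HomologicalComplex.exists_comp_d_eq_of_homologyMap_eq_zero (P := P) g hg
  refine ⟨(Cochain.equivHomotopy g 0).symm
    ⟨Cochain.fromSingleMk z (p := 0) (q := -1) (by simp), ?_⟩⟩
  rw [Cochain.δ_fromSingleMk _ _ 0 0 (by simp), hz, Cochain.ofHom_zero, add_zero]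
  apply (Cochain.fromSingleEquiv (p := 0) (q := 0) (n := 0) (by simp)).injective
  rw [Cochain.fromSingleEquiv_fromSingleMk]
  exact congrArg (_ ≫ ·) (Cochain.ofHom_v g 0)

namespace DerivedCategory

open CochainComplex in
/-- Maps in the derived category from a projective object to a complex are detected on `H⁰`. -/
lemma Q_obj_hom_eq_zero_of_homologyFunctor_map_eq_zero {C : Type*} [Category* C] [Abelian C]
    [HasDerivedCategory C] {P : C} [Projective P] {K : CochainComplex C ℤ}
    (f : Q.obj ((CochainComplex.singleFunctor C 0).obj P) ⟶ Q.obj K)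
    (hf : (homologyFunctor C 0).map f = 0) : f = 0 := by
  obtain ⟨L, _, π, h, g, rfl⟩ := right_fac_of_isStrictlyLE f 0
  have hπ : IsSplitEpi π := by
    rw [isIso_Q_map_iff_quasiIso] at h
    exact CochainComplex.isSplitEpi_to_singleFunctor_obj_of_projective π
  have h₁ : inv (Q.map π) = Q.map (section_ π) := by
    rw [← cancel_mono (Q.map π), IsIso.inv_hom_id, ← Q.map_comp, IsSplitEpi.id, Q.map_id]
  rw [h₁, ← Q.map_comp] at hf ⊢
  have h₂ := homologyFunctorFactors_hom_naturality (section_ π ≫ g) 0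
  rw [hf, zero_comp] at h₂
  have h₃ : HomologicalComplex.homologyMap (section_ π ≫ g) 0 = 0 :=
    (cancel_epi ((homologyFunctorFactors C 0).hom.app _)).1 (h₂.symm.trans comp_zero.symm)
  obtain ⟨H⟩ := nonempty_homotopy_zero_of_homologyMap_eq_zero _ h₃
  rw [Q_map_eq_of_homotopy C H, Functor.map_zero]

/-- Maps in the derived category from a projective object are detected on `H⁰`. -/
lemma eq_zero_of_homologyFunctor_map_eq_zero {C : Type*} [Category* C] [Abelian C]
    [HasDerivedCategory C] {P : C} [Projective P] {X : DerivedCategory C}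
    (f : (singleFunctor C 0).obj P ⟶ X) (hf : (homologyFunctor C 0).map f = 0) : f = 0 := by
  have h₁ : (homologyFunctor C 0).map (f ≫ (Q.objObjPreimageIso X).inv) = 0 := by
    rw [Functor.map_comp, hf, zero_comp]
  have h₂ : f ≫ (Q.objObjPreimageIso X).inv = 0 :=
    Q_obj_hom_eq_zero_of_homologyFunctor_map_eq_zero (P := P) _ h₁
  rw [← cancel_mono (Q.objObjPreimageIso X).inv, zero_comp, h₂]

section ModuleCat

variable {A : Type} [CommRing A] [HasDerivedCategory (ModuleCat.{0} A)]

/-- The `A`-linear map sending a morphism `P ⟶ X` in the derived category to the induced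
map `P ⟶ H⁰(X)`. -/
noncomputable def homologyLinearMap (P : ModuleCat.{0} A) (X : DerivedCategory (ModuleCat.{0} A)) :
    ((singleFunctor (ModuleCat.{0} A) 0).obj P ⟶ X) →ₗ[A]
      (P ⟶ (homologyFunctor (ModuleCat.{0} A) 0).obj X) where
  toFun f := (singleFunctorCompHomologyFunctorIso (ModuleCat.{0} A) 0).inv.app P ≫
    (homologyFunctor (ModuleCat.{0} A) 0).map f
  map_add' f g := by rw [Functor.map_add, Preadditive.comp_add]
  map_smul' a f := by
    have h : a • f = (singleFunctor (ModuleCat.{0} A) 0).map (a • 𝟙 P) ≫ f := by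
      rw [Functor.map_smul, CategoryTheory.Functor.map_id, Linear.smul_comp, Category.id_comp]
    have hn := (singleFunctorCompHomologyFunctorIso (ModuleCat.{0} A) 0).inv.naturality (a • 𝟙 P)
    rw [h, Functor.map_comp]
    dsimp at hn ⊢
    rw [← reassoc_of% hn, Linear.smul_comp, Category.id_comp]

lemma homologyLinearMap_injective (P : ModuleCat.{0} A) [Projective P]
    (X : DerivedCategory (ModuleCat.{0} A)) : Function.Injective (homologyLinearMap P X) := by
  rw [injective_iff_map_eq_zero]
  intro f hf
  apply eq_zero_of_homologyFunctor_map_eq_zero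
  rw [← cancel_epi ((singleFunctorCompHomologyFunctorIso (ModuleCat.{0} A) 0).inv.app P)]
  exact hf.trans comp_zero.symm

lemma finite_hom_self_of_finite_homology [IsNoetherianRing A]
    (X : DerivedCategory (ModuleCat.{0} A))
    [Module.Finite A ((homologyFunctor (ModuleCat.{0} A) 0).obj X)] :
    Module.Finite A ((singleFunctor (ModuleCat.{0} A) 0).obj (ModuleCat.of A A) ⟶ X) := by
  exact Module.Finite.of_injective
    ((ModuleCat.homLinearEquiv (R := A) (S := A)).toLinearMap ∘ₗ
      homologyLinearMap (ModuleCat.of A A) X)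
    ((ModuleCat.homLinearEquiv (R := A) (S := A)).injective.comp (homologyLinearMap_injective _ X))

variable {S : ShortComplex (ModuleCat.{0} A)} (hS : S.ShortExact)
  (X : DerivedCategory (ModuleCat.{0} A))

include hS

lemma finite_hom_of_shortExact_middle [IsNoetherianRing A]
    [Module.Finite A ((singleFunctor (ModuleCat.{0} A) 0).obj S.X₁ ⟶ X)]
    [Module.Finite A ((singleFunctor (ModuleCat.{0} A) 0).obj S.X₃ ⟶ X)] :
    Module.Finite A ((singleFunctor (ModuleCat.{0} A) 0).obj S.X₂ ⟶ X) := by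
  have hT := hS.singleTriangle_distinguished
  have : IsNoetherian A ((singleFunctor (ModuleCat.{0} A) 0).obj S.X₂ ⟶ X) :=
    isNoetherian_of_range_eq_ker
      (Linear.leftComp A X ((singleFunctor (ModuleCat.{0} A) 0).map S.g))
      (Linear.leftComp A X ((singleFunctor (ModuleCat.{0} A) 0).map S.f)) (by
        refine le_antisymm ?_ fun f hf ↦ ?_
        · rintro _ ⟨g, rfl⟩
          simp [← Functor.map_comp_assoc]
        · obtain ⟨g, hg⟩ := Pretriangulated.Triangle.yoneda_exact₂ _ hT f hf
          exact ⟨g, hg.symm⟩)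
  infer_instance

lemma subsingleton_hom_of_shortExact_middle
    [Subsingleton ((singleFunctor (ModuleCat.{0} A) 0).obj S.X₁ ⟶ X)]
    [Subsingleton ((singleFunctor (ModuleCat.{0} A) 0).obj S.X₃ ⟶ X)] :
    Subsingleton ((singleFunctor (ModuleCat.{0} A) 0).obj S.X₂ ⟶ X) := by
  refine subsingleton_of_forall_eq 0 fun f ↦ ?_
  obtain ⟨g, hg⟩ : ∃ g, f = (singleFunctor (ModuleCat.{0} A) 0).map S.g ≫ g :=
    Pretriangulated.Triangle.yoneda_exact₂ _ hS.singleTriangle_distinguished f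
    (Subsingleton.elim (α := (singleFunctor (ModuleCat.{0} A) 0).obj S.X₁ ⟶ X) _ _)
  rw [hg, Subsingleton.elim (α := (singleFunctor (ModuleCat.{0} A) 0).obj S.X₃ ⟶ X) g 0, comp_zero]

lemma finite_hom_of_shortExact_right [IsNoetherianRing A] (n m : ℤ) (hnm : n + 1 = m)
    [Module.Finite A ((singleFunctor (ModuleCat.{0} A) 0).obj S.X₁ ⟶ X⟦n⟧)]
    [Module.Finite A ((singleFunctor (ModuleCat.{0} A) 0).obj S.X₂ ⟶ X⟦m⟧)] :
    Module.Finite A ((singleFunctor (ModuleCat.{0} A) 0).obj S.X₃ ⟶ X⟦m⟧) := by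
  have hT := hS.singleTriangle_distinguished
  let e : (X⟦n⟧)⟦(1 : ℤ)⟧ ≅ X⟦m⟧ :=
    ((shiftFunctorAdd' (DerivedCategory (ModuleCat.{0} A)) n 1 m hnm).app X).symm
  let φ : ((singleFunctor (ModuleCat.{0} A) 0).obj S.X₁ ⟶ X⟦n⟧) →ₗ[A]
      ((singleFunctor (ModuleCat.{0} A) 0).obj S.X₃ ⟶ X⟦m⟧) :=
    Linear.rightComp A _ e.hom ∘ₗ Linear.leftComp A _ hS.singleδ ∘ₗ
      (shiftFunctor (DerivedCategory (ModuleCat.{0} A)) (1 : ℤ)).mapLinearMap A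
  have hφ (f) : φ f = (hS.singleδ ≫ f⟦(1 : ℤ)⟧') ≫ e.hom := rfl
  have : IsNoetherian A ((singleFunctor (ModuleCat.{0} A) 0).obj S.X₃ ⟶ X⟦m⟧) :=
    isNoetherian_of_range_eq_ker φ
      (Linear.leftComp A _ ((singleFunctor (ModuleCat.{0} A) 0).map S.g)) (by
        refine le_antisymm ?_ fun f hf ↦ ?_
        · rintro _ ⟨g, rfl⟩
          have h0 : (singleFunctor (ModuleCat.{0} A) 0).map S.g ≫ hS.singleδ = 0 :=
            Pretriangulated.comp_distTriang_mor_zero₂₃ _ hT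
          simp [hφ, reassoc_of% h0]
        · obtain ⟨g, hg⟩ : ∃ g, f = hS.singleδ ≫ g :=
            Pretriangulated.Triangle.yoneda_exact₃ _ hT f hf
          obtain ⟨g', hg'⟩ := (shiftFunctor (DerivedCategory (ModuleCat.{0} A)) (1 : ℤ)).map_surjective
            (g ≫ e.inv)
          refine ⟨g', ?_⟩
          rw [hφ, hg', hg]
          simp)
  infer_instance

lemma exists_eq_map_comp_of_shortExact (n m : ℤ) (hnm : n + 1 = m)
    [Subsingleton ((singleFunctor (ModuleCat.{0} A) 0).obj S.X₃ ⟶ X⟦m⟧)]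
    (f : (singleFunctor (ModuleCat.{0} A) 0).obj S.X₁ ⟶ X⟦n⟧) :
    ∃ g : (singleFunctor (ModuleCat.{0} A) 0).obj S.X₂ ⟶ X⟦n⟧,
      f = (singleFunctor (ModuleCat.{0} A) 0).map S.f ≫ g := by
  let e : (X⟦n⟧)⟦(1 : ℤ)⟧ ≅ X⟦m⟧ :=
    ((shiftFunctorAdd' (DerivedCategory (ModuleCat.{0} A)) n 1 m hnm).app X).symm
  have h0 : hS.singleδ ≫ f⟦(1 : ℤ)⟧' = 0 := by
    rw [← cancel_mono e.hom]
    exact Subsingleton.elim _ _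
  obtain ⟨g, hg⟩ : ∃ g, f⟦(1 : ℤ)⟧' =
      (-((singleFunctor (ModuleCat.{0} A) 0).map S.f)⟦(1 : ℤ)⟧') ≫ g :=
    Pretriangulated.Triangle.yoneda_exact₂ _ (Pretriangulated.rot_of_distTriang _
      (Pretriangulated.rot_of_distTriang _ hS.singleTriangle_distinguished)) (f⟦(1 : ℤ)⟧') h0
  obtain ⟨g', rfl⟩ :=
    (shiftFunctor (DerivedCategory (ModuleCat.{0} A)) (1 : ℤ)).map_surjective g
  refine ⟨-g', (shiftFunctor (DerivedCategory (ModuleCat.{0} A)) (1 : ℤ)).map_injective ?_⟩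
  rw [hg]
  simp

omit hS

omit [HasDerivedCategory (ModuleCat A)] in
/-- The short exact sequence of `A`-modules attached to an exact pair of linear maps. -/
lemma shortExact_ofHom {N₁ N₂ N₃ : Type} [AddCommGroup N₁] [Module A N₁] [AddCommGroup N₂]
    [Module A N₂] [AddCommGroup N₃] [Module A N₃] (f : N₁ →ₗ[A] N₂) (g : N₂ →ₗ[A] N₃)
    (hf : Function.Injective f) (hg : Function.Surjective g) (hfg : Function.Exact f g) :
    (ShortComplex.mk (ModuleCat.ofHom f) (ModuleCat.ofHom g)
      (by ext x; exact hfg.apply_apply_eq_zero x)).ShortExact where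
  exact := by
    rw [ShortComplex.ShortExact.moduleCat_exact_iff_function_exact]
    exact hfg
  mono_f := (ModuleCat.mono_iff_injective _).2 hf
  epi_g := (ModuleCat.epi_iff_surjective _).2 hg

variable [IsNoetherianRing A]

omit [IsNoetherianRing A] in
lemma subsingleton_hom_of_subsingleton (N : Type) [AddCommGroup N] [Module A N] [Subsingleton N] :
    Subsingleton ((singleFunctor (ModuleCat.{0} A) 0).obj (ModuleCat.of A N) ⟶ X) :=
  subsingleton_of_forall_eq 0 fun _ ↦ ((singleFunctor (ModuleCat.{0} A) 0).map_isZero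
    (ModuleCat.isZero_of_subsingleton (ModuleCat.of A N))).eq_of_src _ _

omit [IsNoetherianRing A] in
lemma finite_homology_shift (n : ℤ)
    [Module.Finite A ((homologyFunctor (ModuleCat.{0} A) n).obj X)] :
    Module.Finite A ((homologyFunctor (ModuleCat.{0} A) 0).obj (X⟦n⟧)) :=
  have : Module.Finite A (((homologyFunctor (ModuleCat.{0} A) 0).shift n).obj X) := ‹_›
  Module.Finite.equiv ((((homologyFunctor (ModuleCat.{0} A) 0).shiftIso n 0 n
    (add_zero n)).app X).symm.toLinearEquiv)

/-- Ext modules from finitely generated modules to bounded-below complexes with finitely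
generated cohomology are finitely generated. -/
theorem finite_hom_shift (i₀ : ℤ) [X.IsGE i₀]
    (hX : ∀ i, Module.Finite A ((homologyFunctor (ModuleCat.{0} A) i).obj X)) (n : ℤ)
    (N : Type) [AddCommGroup N] [Module A N] [Module.Finite A N] :
    Module.Finite A ((singleFunctor (ModuleCat.{0} A) 0).obj (ModuleCat.of A N) ⟶ X⟦n⟧) := by
  have base (n : ℤ) (hn : n < i₀) (N : Type) [AddCommGroup N] [Module A N] :
      Module.Finite A ((singleFunctor (ModuleCat.{0} A) 0).obj (ModuleCat.of A N) ⟶ X⟦n⟧) := by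
    have : (X⟦n⟧).IsGE (i₀ - n) := TStructure.t.isGE_shift X i₀ n (i₀ - n)
    have : Subsingleton
        ((singleFunctor (ModuleCat.{0} A) 0).obj (ModuleCat.of A N) ⟶ X⟦n⟧) :=
      subsingleton_of_forall_eq 0 fun f ↦ TStructure.t.zero f 0 (i₀ - n) (by lia)
    infer_instance
  obtain hn | hn := lt_or_ge n i₀
  · exact base n hn N
  replace hn : i₀ - 1 ≤ n := by lia
  induction n, hn using Int.leInduction generalizing N with
  | base => exact base _ (by lia) N
  | succ n _ ih =>
    have hself : Module.Finite A
        ((singleFunctor (ModuleCat.{0} A) 0).obj (ModuleCat.of A A) ⟶ X⟦n + 1⟧) := by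
      have := hX (n + 1)
      have := finite_homology_shift X (n + 1)
      exact finite_hom_self_of_finite_homology _
    induction ‹Module.Finite A N› using
      IsNoetherianRing.induction_on_isQuotientEquivQuotientPrime A with
    | subsingleton N =>
      have := subsingleton_hom_of_subsingleton (X⟦n + 1⟧) N
      infer_instance
    | quotient N q e =>
      have hS := shortExact_ofHom q.1.subtype (e.symm.toLinearMap ∘ₗ q.1.mkQ)
        q.1.subtype_injective (e.symm.surjective.comp q.1.mkQ_surjective) (by
          rw [LinearMap.exact_iff, LinearMap.ker_comp_of_ker_eq_bot _ e.symm.ker]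
          simp)
      have := ih q.1
      exact finite_hom_of_shortExact_right hS X n (n + 1) rfl
    | exact N₁ N₂ N₃ f g hf hg hfg h₁ h₃ =>
      exact finite_hom_of_shortExact_middle (shortExact_ofHom f g hf hg hfg) (X⟦n + 1⟧)

/-- If every prime containing `I` is equal to `m`, then vanishing of maps out of `A ⧸ m` implies
vanishing of maps out of every finitely generated module annihilated by `I`. -/
theorem subsingleton_hom_of_forall_prime (I m : Ideal A)
    (hI : ∀ q : Ideal A, q.IsPrime → I ≤ q → q = m)
    [hm : Subsingleton ((singleFunctor (ModuleCat.{0} A) 0).obj (ModuleCat.of A (A ⧸ m)) ⟶ X)]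
    (N : Type) [AddCommGroup N] [Module A N] [Module.Finite A N]
    (hN : I ≤ Module.annihilator A N) :
    Subsingleton ((singleFunctor (ModuleCat.{0} A) 0).obj (ModuleCat.of A N) ⟶ X) := by
  induction ‹Module.Finite A N› using
    IsNoetherianRing.induction_on_isQuotientEquivQuotientPrime A with
  | subsingleton N => exact subsingleton_hom_of_subsingleton X N
  | quotient N q e =>
    rw [e.annihilator_eq, Ideal.annihilator_quotient] at hN
    obtain rfl := hI _ q.2 hN
    let e' := (singleFunctor (ModuleCat.{0} A) 0).mapIso e.toModuleIso
    refine ⟨fun f g ↦ ?_⟩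
    rw [← cancel_epi e'.inv]
    exact hm.elim _ _
  | exact N₁ N₂ N₃ f g hf hg hfg h₁ h₃ =>
    have := h₁ (hN.trans (f.annihilator_le_of_injective hf))
    have := h₃ (hN.trans (g.annihilator_le_of_surjective hg))
    exact subsingleton_hom_of_shortExact_middle (shortExact_ofHom f g hf hg hfg) X

end ModuleCat

end DerivedCategory

lemma Ideal.eq_maximalIdeal_of_ringKrullDim_quotient_eq_one {A : Type*} [CommRing A]
    [IsLocalRing A] {p q : Ideal A} [p.IsPrime] [q.IsPrime] (hdim : ringKrullDim (A ⧸ p) = 1)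
    (hpq : p < q) : q = IsLocalRing.maximalIdeal A := by
  have : Ring.KrullDimLE 1 (A ⧸ p) := by
    rw [Ring.krullDimLE_iff, hdim]; rfl
  have hq : (q.map (Ideal.Quotient.mk p)).IsPrime :=
    Ideal.map_isPrime_of_surjective Ideal.Quotient.mk_surjective (by simpa using hpq.le)
  have := (Ring.krullDimLE_one_iff_of_isPrime_bot.1 this) (q.map (Ideal.Quotient.mk p)) (by
    rw [Ne, Ideal.map_eq_bot_iff_le_ker, Ideal.mk_ker]
    exact hpq.not_ge) hq
  have := Ideal.comap_isMaximal_of_surjective (Ideal.Quotient.mk p)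
    Ideal.Quotient.mk_surjective (K := q.map (Ideal.Quotient.mk p))
  rw [Ideal.comap_map_of_surjective _ Ideal.Quotient.mk_surjective, ← RingHom.ker_eq_comap_bot,
    Ideal.mk_ker, sup_eq_left.2 hpq.le] at this
  exact IsLocalRing.eq_maximalIdeal this

/-- **Bass's lemma for complexes (coheight one case; paper's Lemma 3.4).**
Let `(A, m)` be a commutative noetherian local ring, `M` a cohomologically bounded-below
complex of `A`-modules with finitely generated cohomology, and `p ⊆ m` a prime ideal with
`dim(A/p) = 1`. If `Ext^n_A(A/p, M) ≠ 0` for some integer `n`, then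
`Ext^{n+1}_A(A/m, M) ≠ 0`. -/
theorem stmt_2
    (A : Type) [CommRing A] [IsNoetherianRing A] [IsLocalRing A]
    [HasDerivedCategory (ModuleCat A)]
    (M : CochainComplex (ModuleCat A) ℤ)
    (hM : ∃ i₀ : ℤ, ∀ i < i₀, IsZero (M.homology i))
    (hMfg : ∀ i : ℤ, Module.Finite A (M.homology i))
    (p : Ideal A) [p.IsPrime] (hpm : p ≤ IsLocalRing.maximalIdeal A)
    (hdim : ringKrullDim (A ⧸ p) = 1)
    (n : ℤ)
    (h : ∃ f : (DerivedCategory.singleFunctor (ModuleCat A) 0).obj (ModuleCat.of A (A ⧸ p)) ⟶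
        (DerivedCategory.Q.obj M)⟦n⟧, f ≠ 0) :
    ∃ f : (DerivedCategory.singleFunctor (ModuleCat A) 0).obj
        (ModuleCat.of A (IsLocalRing.ResidueField A)) ⟶
        (DerivedCategory.Q.obj M)⟦n + 1⟧, f ≠ 0 := by
  by_contra! hcon
  obtain ⟨f₀, hf₀⟩ := h
  obtain ⟨i₀, hi₀⟩ := hM
  have hGE : (DerivedCategory.Q.obj M).IsGE i₀ := by
    rw [DerivedCategory.isGE_Q_obj_iff, CochainComplex.isGE_iff]
    exact fun i hi ↦ (M.exactAt_iff_isZero_homology i).2 (hi₀ i hi)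
  have hfg (i : ℤ) : Module.Finite A
      ((DerivedCategory.homologyFunctor (ModuleCat.{0} A) i).obj (DerivedCategory.Q.obj M)) :=
    have : Module.Finite A
      ((HomologicalComplex.homologyFunctor (ModuleCat.{0} A) (.up ℤ) i).obj M) := hMfg i
    Module.Finite.equiv
      ((DerivedCategory.homologyFunctorFactors (ModuleCat.{0} A) i).app M).symm.toLinearEquiv
  have hm : Subsingleton ((DerivedCategory.singleFunctor (ModuleCat.{0} A) 0).obj
      (ModuleCat.of A (A ⧸ IsLocalRing.maximalIdeal A)) ⟶ (DerivedCategory.Q.obj M)⟦n + 1⟧) :=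
    subsingleton_of_forall_eq 0 hcon
  have hne : p ≠ IsLocalRing.maximalIdeal A := by
    rintro rfl
    have : ringKrullDim (IsLocalRing.ResidueField A) = 1 := hdim
    simp at this
  obtain ⟨x, hxm, hxp⟩ := SetLike.exists_of_lt (lt_of_le_of_ne hpm hne)
  let μ : (A ⧸ p) →ₗ[A] (A ⧸ p) := x • LinearMap.id
  have hμ : Function.Injective μ := by
    rw [← LinearMap.ker_eq_bot, LinearMap.ker_eq_bot']
    intro y hy
    obtain ⟨y, rfl⟩ := Ideal.Quotient.mk_surjective y
    have : x * y ∈ p := Ideal.Quotient.eq_zero_iff_mem.1 hy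
    exact Ideal.Quotient.eq_zero_iff_mem.2 ((‹p.IsPrime›.mem_or_mem this).resolve_left hxp)
  have hS := DerivedCategory.shortExact_ofHom μ (LinearMap.range μ).mkQ hμ
    (Submodule.mkQ_surjective _) (LinearMap.exact_map_mkQ_range μ)
  have hann : p ⊔ Ideal.span {x} ≤ Module.annihilator A ((A ⧸ p) ⧸ LinearMap.range μ) := by
    rw [sup_le_iff, Ideal.span_singleton_le_iff_mem]
    constructor
    · refine le_trans ?_ ((LinearMap.range μ).mkQ.annihilator_le_of_surjective
        (Submodule.mkQ_surjective _))
      rw [Ideal.annihilator_quotient]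
    · rw [Module.mem_annihilator]
      intro y
      obtain ⟨y, rfl⟩ := Submodule.mkQ_surjective _ y
      exact (Submodule.Quotient.mk_eq_zero _).2 ⟨y, rfl⟩
  have hsub := DerivedCategory.subsingleton_hom_of_forall_prime
    ((DerivedCategory.Q.obj M)⟦n + 1⟧) (p ⊔ Ideal.span {x}) (IsLocalRing.maximalIdeal A)
    (fun q hq hle ↦ Ideal.eq_maximalIdeal_of_ringKrullDim_quotient_eq_one hdim
      (lt_of_le_of_ne (le_sup_left.trans hle) (by
        rintro rfl
        exact hxp (hle (Ideal.mem_sup_right (Ideal.mem_span_singleton_self x))))))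
    ((A ⧸ p) ⧸ LinearMap.range μ) hann
  have hfin := DerivedCategory.finite_hom_shift (DerivedCategory.Q.obj M) i₀ hfg n (A ⧸ p)
  have hbot := Submodule.eq_bot_of_le_smul_of_le_jacobson_bot (IsLocalRing.maximalIdeal A)
    (⊤ : Submodule A ((DerivedCategory.singleFunctor (ModuleCat.{0} A) 0).obj
      (ModuleCat.of A (A ⧸ p)) ⟶ (DerivedCategory.Q.obj M)⟦n⟧)) hfin.fg_top (by
      intro f _
      obtain ⟨g, rfl⟩ := DerivedCategory.exists_eq_map_comp_of_shortExact hS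
        (DerivedCategory.Q.obj M) n (n + 1) rfl f
      have hx : ModuleCat.ofHom μ = x • 𝟙 (ModuleCat.of A (A ⧸ p)) := rfl
      dsimp only
      rw [hx, Functor.map_smul, CategoryTheory.Functor.map_id, Linear.smul_comp, Category.id_comp]
      exact Submodule.smul_mem_smul hxm trivial)
    (IsLocalRing.maximalIdeal_le_jacobson _)
  have : f₀ ∈ (⊤ : Submodule A ((DerivedCategory.singleFunctor (ModuleCat.{0} A) 0).obj
      (ModuleCat.of A (A ⧸ p)) ⟶ (DerivedCategory.Q.obj M)⟦n⟧)) := trivial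
  rw [hbot] at this
  exact hf₀ this
end

section
/- Let (A, m) be a commutative noetherian local ring, let M be a nonzero cohomologically bounded-below complex of A-modules all of whose cohomology modules are finitely generated, and set i₀ = inf(M). Let p be a prime ideal of A such that H^{i₀}(M)_p ≠ 0 and Ext^{i₀}_{A_p}(A_p/pA_p, M_p) ≠ 0 (i.e., p is an associated prime of M lying in the support of H^{i₀}(M)). Then Ext^{i₀ + dim(A/p)}_A(A/m, M) ≠ 0; consequently depth_A(M) ≤ i₀ + dim(A/p), i.e., the sequential depth of M satisfies seq.depth_A(m, M) ≤ dim(A/p). -/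
open CategoryTheory Limits

/-- Extension of scalars is an additive functor (it is a left adjoint between
preadditive categories with binary biproducts). -/
noncomputable instance extendScalarsAdditive {R S : Type} [CommRing R] [CommRing S]
    (f : R →+* S) : (ModuleCat.extendScalars.{0,0,0} f).Additive := by
  have adj := ModuleCat.extendRestrictScalarsAdj.{0,0,0} f
  have : (ModuleCat.extendScalars.{0,0,0} f).IsLeftAdjoint := ⟨_, ⟨adj⟩⟩
  have h1 : PreservesColimitsOfSize.{0,0} (ModuleCat.extendScalars.{0,0,0} f) :=
    adj.leftAdjoint_preservesColimits
  have h2 : PreservesBinaryBiproducts (ModuleCat.extendScalars.{0,0,0} f) :=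
    preservesBinaryBiproducts_of_preservesBinaryCoproducts _
  exact Functor.additive_of_preservesBinaryBiproducts _

universe w w₁

section Ext

variable {R : Type} [CommRing R] [HasDerivedCategory.{w} (ModuleCat R)]
  (X : DerivedCategory (ModuleCat R))

/-- The `R`-module `Ext^n_R(N, X)` of morphisms `N ⟶ X[n]` in the derived category. -/
abbrev DExt (N : Type) [AddCommGroup N] [Module R N] (n : ℤ) :=
  (DerivedCategory.singleFunctor (ModuleCat R) 0).obj (ModuleCat.of R N) ⟶ X⟦n⟧

namespace DExt

variable {N N₁ N₂ N₃ : Type} [AddCommGroup N] [Module R N] [AddCommGroup N₁] [Module R N₁]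
  [AddCommGroup N₂] [Module R N₂] [AddCommGroup N₃] [Module R N₃]

/-- Precomposition with a linear map. -/
noncomputable def pre (f : N₁ →ₗ[R] N₂) (n : ℤ) : DExt X N₂ n →ₗ[R] DExt X N₁ n :=
  Linear.leftComp R _ ((DerivedCategory.singleFunctor (ModuleCat R) 0).map (ModuleCat.ofHom f))

lemma pre_apply (f : N₁ →ₗ[R] N₂) (n : ℤ) (y : DExt X N₂ n) :
    pre X f n y =
      (DerivedCategory.singleFunctor (ModuleCat R) 0).map (ModuleCat.ofHom f) ≫ y := rfl

lemma pre_comp (f : N₁ →ₗ[R] N₂) (g : N₂ →ₗ[R] N₃) (n : ℤ) (y : DExt X N₃ n) :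
    pre X (g ∘ₗ f) n y = pre X f n (pre X g n y) := by
  simp [pre_apply, ModuleCat.ofHom_comp]

lemma pre_smul (r : R) (f : N₁ →ₗ[R] N₂) (n : ℤ) (y : DExt X N₂ n) :
    pre X (r • f) n y = r • pre X f n y := by
  have : ModuleCat.ofHom (r • f) = r • ModuleCat.ofHom f := rfl
  simp [pre_apply, this, Functor.map_smul]

lemma pre_id (n : ℤ) (y : DExt X N n) : pre X (LinearMap.id : N →ₗ[R] N) n y = y := by
  simp [pre_apply]

lemma pre_zero (n : ℤ) (y : DExt X N₂ n) : pre X (0 : N₁ →ₗ[R] N₂) n y = 0 := by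
  have : ModuleCat.ofHom (0 : N₁ →ₗ[R] N₂) = 0 := rfl
  simp [pre_apply, this]

/-- A linear equivalence induces an equivalence on `DExt`. -/
noncomputable def congr (e : N₁ ≃ₗ[R] N₂) (n : ℤ) : DExt X N₂ n ≃ₗ[R] DExt X N₁ n :=
  LinearEquiv.ofLinearMap (pre X e.toLinearMap n) (pre X e.symm.toLinearMap n)
    (by ext y; simp [← pre_comp, pre_id]) (by ext y; simp [← pre_comp, pre_id])

lemma eq_zero_of_subsingleton [Subsingleton N] (n : ℤ) (y : DExt X N n) : y = 0 := by
  rw [← pre_id X n y, Subsingleton.elim (LinearMap.id : N →ₗ[R] N) 0, pre_zero]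

lemma smul_eq_zero_of_mem (I : Ideal R) (n : ℤ) (y : DExt X (R ⧸ I) n) (a : R) (ha : a ∈ I) :
    a • y = 0 := by
  rw [← pre_id X n y, ← pre_smul, show a • (LinearMap.id : (R ⧸ I) →ₗ[R] _) = 0 from ?_,
    pre_zero]
  ext
  change Ideal.Quotient.mk I (a * 1) = 0
  rw [mul_one]
  exact Ideal.Quotient.eq_zero_iff_mem.mpr ha

section SES

variable {f : N₁ →ₗ[R] N₂} {g : N₂ →ₗ[R] N₃} (hf : Function.Injective f)
  (hfg : Function.Exact f g) (hg : Function.Surjective g)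

/-- The short exact sequence in `ModuleCat R` attached to a short exact sequence of modules. -/
abbrev sc (hfg : Function.Exact f g) : ShortComplex (ModuleCat R) :=
  ShortComplex.mk (ModuleCat.ofHom f) (ModuleCat.ofHom g)
    (by ext x; exact hfg.apply_apply_eq_zero x)

omit [HasDerivedCategory.{w} (ModuleCat R)] in
include hf hg in
lemma sc_shortExact : (sc hfg).ShortExact :=
  ModuleCat.shortComplex_shortExact _ hfg hf hg

/-- The third map of the distinguished triangle attached to a short exact sequence. -/
noncomputable def δ : (DerivedCategory.singleFunctor (ModuleCat R) 0).obj (ModuleCat.of R N₃) ⟶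
    ((DerivedCategory.singleFunctor (ModuleCat R) 0).obj (ModuleCat.of R N₁))⟦(1 : ℤ)⟧ :=
  (sc_shortExact hf hfg hg).singleδ

lemma triangle_distinguished :
    Pretriangulated.Triangle.mk
      ((DerivedCategory.singleFunctor (ModuleCat R) 0).map (ModuleCat.ofHom f))
      ((DerivedCategory.singleFunctor (ModuleCat R) 0).map (ModuleCat.ofHom g))
      (δ hf hfg hg) ∈ Pretriangulated.distinguishedTriangles :=
  (sc_shortExact hf hfg hg).singleTriangle_distinguished

include hf hg hfg in
lemma exact_pre (n : ℤ) : Function.Exact (pre X g n) (pre X f n) := by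
  intro y
  constructor
  · intro hy
    obtain ⟨z, hz⟩ := Pretriangulated.Triangle.yoneda_exact₂ _
      (triangle_distinguished hf hfg hg) y hy
    exact ⟨z, hz.symm⟩
  · rintro ⟨z, rfl⟩
    rw [← pre_comp, hfg.linearMap_comp_eq_zero, pre_zero]

/-- The connecting homomorphism. -/
noncomputable def conn (n n' : ℤ) (hn : n + 1 = n') : DExt X N₁ n →ₗ[R] DExt X N₃ n' where
  toFun y := δ hf hfg hg ≫ y⟦(1 : ℤ)⟧' ≫
    (shiftFunctorAdd' (DerivedCategory (ModuleCat R)) n 1 n' hn).inv.app X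
  map_add' y z := by simp [Functor.map_add]
  map_smul' r y := by simp [Functor.map_smul]

lemma conn_apply (n n' : ℤ) (hn : n + 1 = n') (y : DExt X N₁ n) :
    conn X hf hfg hg n n' hn y = δ hf hfg hg ≫ y⟦(1 : ℤ)⟧' ≫
      (shiftFunctorAdd' (DerivedCategory (ModuleCat R)) n 1 n' hn).inv.app X := rfl

lemma exact_conn_pre (n n' : ℤ) (hn : n + 1 = n') :
    Function.Exact (conn X hf hfg hg n n' hn) (pre X g n') := by
  have h0 := triangle_distinguished hf hfg hg
  intro y
  constructor
  · intro hy
    obtain ⟨z, hz⟩ : ∃ z, y = δ hf hfg hg ≫ z :=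
      Pretriangulated.Triangle.yoneda_exact₃ _ h0 y hy
    obtain ⟨z', hz'⟩ := (shiftFunctor (DerivedCategory (ModuleCat R)) (1 : ℤ)).map_surjective
      (z ≫ (shiftFunctorAdd' (DerivedCategory (ModuleCat R)) n 1 n' hn).hom.app X)
    exact ⟨z', by simp [conn_apply, hz', hz]⟩
  · rintro ⟨z, rfl⟩
    have : (DerivedCategory.singleFunctor (ModuleCat R) 0).map (ModuleCat.ofHom g) ≫
        δ hf hfg hg = 0 := Pretriangulated.comp_distTriang_mor_zero₂₃ _ h0
    simp [conn_apply, pre_apply, reassoc_of% this]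

lemma exact_pre_conn (n n' : ℤ) (hn : n + 1 = n') :
    Function.Exact (pre X f n) (conn X hf hfg hg n n' hn) := by
  have h0 := triangle_distinguished hf hfg hg
  intro y
  constructor
  · intro hy
    have hy' : δ hf hfg hg ≫ y⟦(1 : ℤ)⟧' = 0 := by
      rw [← cancel_mono ((shiftFunctorAdd' (DerivedCategory (ModuleCat R)) n 1 n' hn).inv.app X),
        Category.assoc, zero_comp]
      exact hy
    obtain ⟨z, hz⟩ : ∃ z, y⟦(1 : ℤ)⟧' = (-((DerivedCategory.singleFunctor
        (ModuleCat R) 0).map (ModuleCat.ofHom f))⟦(1 : ℤ)⟧') ≫ z :=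
      Pretriangulated.Triangle.yoneda_exact₃ _
        (Pretriangulated.rot_of_distTriang _ h0) (y⟦(1 : ℤ)⟧') hy'
    obtain ⟨z', rfl⟩ := (shiftFunctor (DerivedCategory (ModuleCat R)) (1 : ℤ)).map_surjective z
    refine ⟨-z', (shiftFunctor (DerivedCategory (ModuleCat R)) (1 : ℤ)).map_injective ?_⟩
    rw [hz, pre_apply]
    simp [Functor.map_comp, Functor.map_neg]
  · rintro ⟨z, rfl⟩
    have : δ hf hfg hg ≫ ((DerivedCategory.singleFunctor (ModuleCat R) 0).map
        (ModuleCat.ofHom f))⟦(1 : ℤ)⟧' = 0 := Pretriangulated.comp_distTriang_mor_zero₃₁ _ h0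
    simp [conn_apply, pre_apply, reassoc_of% this]

end SES

lemma eq_zero_of_lt (i₀ n : ℤ) [X.IsGE i₀] (hn : n < i₀) (y : DExt X N n) : y = 0 := by
  have := DerivedCategory.TStructure.t.isGE_shift X i₀ n (i₀ - n)
  exact DerivedCategory.TStructure.t.zero_of_isLE_of_isGE y 0 (i₀ - n) (by lia)
    inferInstance inferInstance

end DExt

end Ext

section Homology

variable {R : Type} [CommRing R]

/-- Homology of a complex of modules as cycles modulo boundaries. -/
noncomputable def homologyEquivQuotient (M : CochainComplex (ModuleCat R) ℤ) (n : ℤ) :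
    M.homology n ≃ₗ[R] LinearMap.ker (M.d n (n + 1)).hom ⧸
      (LinearMap.range (M.d (n - 1) n).hom).submoduleOf (LinearMap.ker (M.d n (n + 1)).hom) :=
  ((M.homologyIsoSc' (n - 1) n (n + 1) (by simp) (by simp)) ≪≫
    (M.sc' (n - 1) n (n + 1)).moduleCatHomologyIso).toLinearEquiv ≪≫ₗ
    Submodule.quotEquivOfEq _ _ (by
      ext x
      simp only [LinearMap.mem_range, Submodule.submoduleOf]
      constructor
      · rintro ⟨y, rfl⟩; exact ⟨y, rfl⟩
      · rintro ⟨y, hy⟩; exact ⟨y, Subtype.ext hy⟩)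

instance (P : ModuleCat R) [Projective P] :
    ((CochainComplex.singleFunctor (ModuleCat R) 0).obj P).IsKProjective := by
  have (n : ℤ) : Projective (((CochainComplex.singleFunctor (ModuleCat R) 0).obj P).X n) := by
    by_cases hn : n = 0
    · subst hn
      exact Projective.of_iso (HomologicalComplex.singleObjXSelf (.up ℤ) 0 P).symm inferInstance
    · have := (HomologicalComplex.isZero_single_obj_X (.up ℤ) 0 P n hn)
      exact Projective.of_iso (this.iso (isZero_zero _)).symm inferInstance
  exact CochainComplex.isKProjective_of_projective _ 0

open CochainComplex HomComplex

/-- The cocycle with values in `M` attached to a cycle. -/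
noncomputable def cocycleOfCycle (M : CochainComplex (ModuleCat R) ℤ) (n : ℤ)
    (z : LinearMap.ker (M.d n (n + 1)).hom) :
    Cocycle ((CochainComplex.singleFunctor (ModuleCat R) 0).obj (ModuleCat.of R R)) M n :=
  Cocycle.fromSingleMk (ModuleCat.ofHom (LinearMap.toSpanSingleton R (M.X n) z.1)) (zero_add n)
    (n + 1) rfl (by ext; simp)

lemma cocycleOfCycle_mem_coboundaries (M : CochainComplex (ModuleCat R) ℤ) (n : ℤ)
    (z : LinearMap.ker (M.d n (n + 1)).hom) :
    cocycleOfCycle M n z ∈ coboundaries _ _ _ ↔ z.1 ∈ LinearMap.range (M.d (n - 1) n).hom := by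
  rw [cocycleOfCycle, Cocycle.fromSingleMk_mem_coboundaries_iff (q'' := n - 1) (hq'' := by simp)]
  constructor
  · rintro ⟨g, hg⟩
    refine ⟨g.hom 1, ?_⟩
    have := congrArg (fun k => k.hom 1) hg
    simpa using this
  · rintro ⟨y, hy⟩
    refine ⟨ModuleCat.ofHom (LinearMap.toSpanSingleton R _ y), ?_⟩
    ext
    simpa using hy

lemma cocycleOfCycle_surjective (M : CochainComplex (ModuleCat R) ℤ) (n : ℤ) :
    Function.Surjective (cocycleOfCycle M n) := by
  intro α
  obtain ⟨f, hf, rfl⟩ := Cocycle.fromSingleMk_surjective α n (zero_add n) (n + 1) rfl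
  refine ⟨⟨f.hom 1, ?_⟩, ?_⟩
  · have := congrArg (fun k => k.hom 1) hf
    simpa using this
  · have : ModuleCat.ofHom (LinearMap.toSpanSingleton R (M.X n) (f.hom 1)) = f := by
      ext; simp
    simp [cocycleOfCycle, this]

lemma cocycleOfCycle_add (M : CochainComplex (ModuleCat R) ℤ) (n : ℤ)
    (z z' : LinearMap.ker (M.d n (n + 1)).hom) :
    cocycleOfCycle M n (z + z') = cocycleOfCycle M n z + cocycleOfCycle M n z' := by
  simp only [cocycleOfCycle, ← Cocycle.fromSingleMk_add]
  congr 1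
  ext; simp

lemma cocycleOfCycle_smul (M : CochainComplex (ModuleCat R) ℤ) (n : ℤ) (r : R)
    (z : LinearMap.ker (M.d n (n + 1)).hom) :
    cocycleOfCycle M n (r • z) = (cocycleOfCycle M n z).precomp
      ((CochainComplex.singleFunctor (ModuleCat R) 0).map (r • 𝟙 _)) := by
  simp only [cocycleOfCycle, ← Cocycle.fromSingleMk_precomp]
  congr 1
  ext; simp

variable [HasDerivedCategory.{w} (ModuleCat R)]

lemma Q_map_surjective_of_isKProjective (K L : CochainComplex (ModuleCat R) ℤ) [K.IsKProjective]
    (y : DerivedCategory.Q.obj K ⟶ DerivedCategory.Q.obj L) :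
    ∃ φ : K ⟶ L, DerivedCategory.Q.map φ = y := by
  obtain ⟨g, hg⟩ := (IsKProjective.Qh_map_bijective K
    ((HomotopyCategory.quotient _ _).obj L)).surjective
    ((DerivedCategory.quotientCompQhIso _).hom.app K ≫ y ≫
      (DerivedCategory.quotientCompQhIso _).inv.app L)
  obtain ⟨φ, rfl⟩ := (HomotopyCategory.quotient _ _).map_surjective g
  refine ⟨φ, ?_⟩
  have := (DerivedCategory.quotientCompQhIso (ModuleCat R)).inv.naturality φ
  rw [← cancel_mono ((DerivedCategory.quotientCompQhIso _).inv.app L), this]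
  dsimp
  rw [hg]
  simp

lemma Q_map_eq_zero_iff_of_isKProjective {K L : CochainComplex (ModuleCat R) ℤ} [K.IsKProjective]
    (φ : K ⟶ L) : DerivedCategory.Q.map φ = 0 ↔
      (HomotopyCategory.quotient (ModuleCat R) (.up ℤ)).map φ = 0 := by
  have := (DerivedCategory.quotientCompQhIso (ModuleCat R)).inv.naturality φ
  rw [← cancel_mono ((DerivedCategory.quotientCompQhIso _).inv.app L), this, zero_comp,
    Preadditive.IsIso.comp_left_eq_zero]
  refine ⟨fun h => (IsKProjective.Qh_map_bijective K
    ((HomotopyCategory.quotient _ _).obj L)).injective ?_, fun h => ?_⟩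
  · rw [Functor.map_zero]
    exact h
  · change DerivedCategory.Qh.map ((HomotopyCategory.quotient _ _).map φ) = 0
    rw [h, Functor.map_zero]

/-- The map from cycles to `Ext^n_R(R, M)`. -/
noncomputable def cyclesToDExt (M : CochainComplex (ModuleCat R) ℤ) (n : ℤ) :
    LinearMap.ker (M.d n (n + 1)).hom →ₗ[R] DExt (DerivedCategory.Q.obj M) R n where
  toFun z := (DerivedCategory.singleFunctorIsoCompQ (ModuleCat R) 0).hom.app (ModuleCat.of R R) ≫
    DerivedCategory.Q.map (Cocycle.equivHomShift.symm (cocycleOfCycle M n z)) ≫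
      (DerivedCategory.Q.commShiftIso n).hom.app M
  map_add' z z' := by
    rw [cocycleOfCycle_add, map_add, Functor.map_add, Preadditive.add_comp, Preadditive.comp_add]
  map_smul' r z := by
    rw [cocycleOfCycle_smul, Cocycle.equivHomShift_symm_precomp, Functor.map_smul,
      CategoryTheory.Functor.map_id, Linear.smul_comp, Category.id_comp, Functor.map_smul,
      Linear.smul_comp,
      Linear.comp_smul]
    rfl

lemma cyclesToDExt_surjective (M : CochainComplex (ModuleCat R) ℤ) (n : ℤ) :
    Function.Surjective (cyclesToDExt M n) := by
  intro y
  obtain ⟨φ, hφ⟩ := Q_map_surjective_of_isKProjective _ _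
    ((DerivedCategory.singleFunctorIsoCompQ (ModuleCat R) 0).inv.app (ModuleCat.of R R) ≫ y ≫
      (DerivedCategory.Q.commShiftIso n).inv.app M)
  obtain ⟨z, hz⟩ := cocycleOfCycle_surjective M n (Cocycle.equivHomShift φ)
  refine ⟨z, ?_⟩
  change _ ≫ _ ≫ _ = _
  rw [hz, AddEquiv.symm_apply_apply, hφ]
  simp

lemma ker_cyclesToDExt (M : CochainComplex (ModuleCat R) ℤ) (n : ℤ) :
    LinearMap.ker (cyclesToDExt M n) =
      (LinearMap.range (M.d (n - 1) n).hom).submoduleOf (LinearMap.ker (M.d n (n + 1)).hom) := by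
  ext z
  rw [LinearMap.mem_ker, Submodule.submoduleOf, Submodule.mem_comap, Submodule.subtype_apply,
    ← cocycleOfCycle_mem_coboundaries, ← CohomologyClass.toHom_mk_eq_zero_iff,
    CohomologyClass.toHom_mk, ← Q_map_eq_zero_iff_of_isKProjective]
  change _ ≫ _ ≫ _ = _ ↔ _
  rw [Preadditive.IsIso.comp_left_eq_zero, Preadditive.IsIso.comp_right_eq_zero]

/-- `Ext^n_R(R, M)` is the `n`-th cohomology of `M`. -/
noncomputable def homologyEquivDExt (M : CochainComplex (ModuleCat R) ℤ) (n : ℤ) :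
    M.homology n ≃ₗ[R] DExt (DerivedCategory.Q.obj M) R n :=
  homologyEquivQuotient M n ≪≫ₗ Submodule.quotEquivOfEq _ _ (ker_cyclesToDExt M n).symm ≪≫ₗ
    (cyclesToDExt M n).quotKerEquivOfSurjective (cyclesToDExt_surjective M n)

end Homology

lemma exists_covBy_of_coheight_eq {α : Type*} [Preorder α] {x : α} {n : ℕ}
    (hx : Order.coheight x = n + 1) : ∃ y, x ⋖ y ∧ Order.coheight y = n := by
  obtain ⟨-, ⟨y, hxy, hy⟩, h⟩ := Order.coheight_eq_coe_add_one_iff.mp hx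
  refine ⟨y, ⟨hxy, fun z hxz hzy => ?_⟩, hy⟩
  have h₁ := Order.coheight_add_one_le hzy
  have h₂ := h z hxz
  rw [hy] at h₁
  exact absurd (h₁.trans h₂) (by norm_cast; simp)

section Bass

variable {R : Type} [CommRing R] [IsNoetherianRing R] [HasDerivedCategory.{w} (ModuleCat R)]
  (X : DerivedCategory (ModuleCat R))

open scoped Pointwise

namespace DExt

lemma isNoetherian_of_isQuotientEquivQuotientPrime (n : ℤ)
    (h : ∀ p : PrimeSpectrum R, IsNoetherian R (DExt X (R ⧸ p.asIdeal) n))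
    (N : Type) [AddCommGroup N] [Module R N] [hN : Module.Finite R N] :
    IsNoetherian R (DExt X N n) := by
  refine IsNoetherianRing.induction_on_isQuotientEquivQuotientPrime R hN
    (motive := fun N _ _ _ => IsNoetherian R (DExt X N n)) ?_ ?_ ?_
  · intro N _ _ _ _
    have : Subsingleton (DExt X N n) := subsingleton_of_forall_eq 0 (eq_zero_of_subsingleton X n)
    infer_instance
  · intro N _ _ _ p e
    have := h p
    exact isNoetherian_of_linearEquiv (congr X e n)
  · intro N₁ _ _ _ N₂ _ _ _ N₃ _ _ _ f g hf hg hfg h₁ h₃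
    exact isNoetherian_of_range_eq_ker (pre X g n) (pre X f n)
      ((exact_pre X hf hfg hg n).linearMap_ker_eq).symm

lemma isNoetherian (i₀ : ℤ) [X.IsGE i₀] (hX : ∀ n, IsNoetherian R (DExt X R n)) (n : ℤ)
    (N : Type) [AddCommGroup N] [Module R N] [Module.Finite R N] :
    IsNoetherian R (DExt X N n) := by
  by_cases hn : i₀ ≤ n
  · induction n, hn using Int.leInduction generalizing N with
    | base =>
      refine isNoetherian_of_isQuotientEquivQuotientPrime X _ (fun p => ?_) N
      have := hX i₀
      refine isNoetherian_of_injective (pre X p.asIdeal.mkQ i₀) ?_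
      rw [injective_iff_map_eq_zero]
      intro y hy
      obtain ⟨z, rfl⟩ := (exact_conn_pre X (Submodule.subtype_injective p.asIdeal)
        (LinearMap.exact_subtype_mkQ p.asIdeal) (Submodule.mkQ_surjective _)
        (i₀ - 1) i₀ (by lia) y).mp hy
      rw [eq_zero_of_lt X i₀ (i₀ - 1) (by lia) z, map_zero]
    | succ n hn ih =>
      refine isNoetherian_of_isQuotientEquivQuotientPrime X _ (fun p => ?_) N
      have := hX (n + 1)
      have := ih p.asIdeal
      exact isNoetherian_of_range_eq_ker _ _ ((exact_conn_pre X
        (Submodule.subtype_injective p.asIdeal) (LinearMap.exact_subtype_mkQ p.asIdeal)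
        (Submodule.mkQ_surjective _) n (n + 1) rfl).linearMap_ker_eq).symm
  · have : Subsingleton (DExt X N n) :=
      subsingleton_of_forall_eq 0 (eq_zero_of_lt X i₀ n (by lia))
    infer_instance

omit [IsNoetherianRing R] in
lemma pre_injective_of_surjective {N N' : Type} [AddCommGroup N] [Module R N] [AddCommGroup N']
    [Module R N'] (i₀ : ℤ) [X.IsGE i₀] {g : N →ₗ[R] N'} (hg : Function.Surjective g) :
    Function.Injective (pre X g i₀) := by
  rw [injective_iff_map_eq_zero]
  intro y hy
  obtain ⟨z, rfl⟩ := (exact_conn_pre X (Submodule.subtype_injective (LinearMap.ker g))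
    (LinearMap.exact_subtype_ker_map g) hg (i₀ - 1) i₀ (by lia) y).mp hy
  rw [eq_zero_of_lt X i₀ (i₀ - 1) (by lia) z, map_zero]

lemma eq_zero_of_forall_pre_eq_zero (i₀ : ℤ) [X.IsGE i₀]
    (N : Type) [AddCommGroup N] [Module R N] [hN : Module.Finite R N]
    (y : DExt X N i₀) (hy : ∀ h : R →ₗ[R] N, pre X h i₀ y = 0) : y = 0 := by
  revert y
  refine IsNoetherianRing.induction_on_isQuotientEquivQuotientPrime R hN
    (motive := fun N _ _ _ => ∀ y : DExt X N i₀, (∀ h : R →ₗ[R] N, pre X h i₀ y = 0) → y = 0)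
    ?_ ?_ ?_
  · intro N _ _ _ _ y _
    exact eq_zero_of_subsingleton X i₀ y
  · intro N _ _ _ p e y hy
    exact pre_injective_of_surjective X i₀ (g := e.symm.toLinearMap ∘ₗ p.asIdeal.mkQ)
      (e.symm.surjective.comp (Submodule.mkQ_surjective _)) (by rw [hy, map_zero])
  · intro N₁ _ _ _ N₂ _ _ _ N₃ _ _ _ f g hf hg hfg h₁ h₃ y hy
    obtain ⟨z, rfl⟩ := (exact_pre X hf hfg hg i₀ y).mp
      (h₁ _ fun h => by rw [← pre_comp]; exact hy _)
    rw [h₃ z fun h => ?_, map_zero]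
    obtain ⟨b, hb⟩ := hg (h 1)
    have : h = g ∘ₗ LinearMap.toSpanSingleton R N₂ b := by ext; simp [hb]
    rw [this, pre_comp]
    exact hy _

lemma exists_prime_of_mem_support (n : ℤ) (q : PrimeSpectrum R)
    (N : Type) [AddCommGroup N] [Module R N] [hN : Module.Finite R N]
    (hq : q ∈ Module.support R (DExt X N n)) :
    ∃ p ∈ Module.support R N, q ∈ Module.support R (DExt X (R ⧸ p.asIdeal) n) := by
  revert hq
  refine IsNoetherianRing.induction_on_isQuotientEquivQuotientPrime R hN
    (motive := fun N _ _ _ => q ∈ Module.support R (DExt X N n) →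
      ∃ p ∈ Module.support R N, q ∈ Module.support R (DExt X (R ⧸ p.asIdeal) n)) ?_ ?_ ?_
  · intro N _ _ _ _ hq
    obtain ⟨m, hm⟩ := Module.mem_support_iff'.mp hq
    exact (hm 1 (q.asIdeal.ne_top_iff_one.mp q.isPrime.ne_top)
      (eq_zero_of_subsingleton X n _)).elim
  · intro N _ _ _ p e hq
    refine ⟨p, ?_, by rwa [(congr X e n).support_eq]⟩
    rw [e.support_eq, Module.mem_support_iff_of_finite, Ideal.annihilator_quotient]
  · intro N₁ _ _ _ N₂ _ _ _ N₃ _ _ _ f g hf hg hfg h₁ h₃ hq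
    by_cases hq₁ : q ∈ Module.support R (DExt X N₁ n)
    · obtain ⟨p, hp, h⟩ := h₁ hq₁
      exact ⟨p, Module.support_subset_of_injective f hf hp, h⟩
    by_cases hq₃ : q ∈ Module.support R (DExt X N₃ n)
    · obtain ⟨p, hp, h⟩ := h₃ hq₃
      exact ⟨p, Module.support_subset_of_surjective g hg hp, h⟩
    rw [Module.notMem_support_iff'] at hq₁ hq₃
    refine absurd hq (Module.notMem_support_iff'.mpr fun y => ?_)
    obtain ⟨r, hr, hry⟩ := hq₁ (pre X f n y)
    obtain ⟨z, hz⟩ := (exact_pre X hf hfg hg n (r • y)).mp (by rw [map_smul, hry])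
    obtain ⟨s, hs, hsz⟩ := hq₃ z
    refine ⟨s * r, q.isPrime.mul_notMem hs hr, ?_⟩
    rw [mul_smul, ← hz, ← map_smul, hsz, map_zero]

omit [IsNoetherianRing R] in
lemma le_of_mem_support (n : ℤ) (p q : PrimeSpectrum R)
    (hq : q ∈ Module.support R (DExt X (R ⧸ p.asIdeal) n)) : p ≤ q := by
  change p.asIdeal ≤ q.asIdeal
  refine le_trans (fun a ha => ?_) (Module.annihilator_le_of_mem_support hq)
  rw [Module.mem_annihilator]
  exact fun y => smul_eq_zero_of_mem X p.asIdeal n y a ha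

/-- Passing from a prime to an immediate specialization raises the degree of a non-vanishing
`Ext` by one. -/
lemma mem_support_of_covBy (n : ℤ) (p q : PrimeSpectrum R) (hpq : p ⋖ q)
    (hX : Module.Finite R (DExt X (R ⧸ p.asIdeal) n))
    (hp : p ∈ Module.support R (DExt X (R ⧸ p.asIdeal) n)) :
    q ∈ Module.support R (DExt X (R ⧸ q.asIdeal) (n + 1)) := by
  obtain ⟨x, hxq, hxp⟩ := Set.exists_of_ssubset (show (p.asIdeal : Set R) ⊂ q.asIdeal from hpq.lt)
  have hf : Function.Injective (x • LinearMap.id : (R ⧸ p.asIdeal) →ₗ[R] (R ⧸ p.asIdeal)) := by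
    rw [injective_iff_map_eq_zero]
    intro a ha
    obtain ⟨a, rfl⟩ := Ideal.Quotient.mk_surjective a
    have : Ideal.Quotient.mk p.asIdeal (x * a) = 0 := ha
    rw [Ideal.Quotient.eq_zero_iff_mem] at this ⊢
    exact (p.isPrime.mem_or_mem this).resolve_left hxp
  have hfg : Function.Exact (x • LinearMap.id : (R ⧸ p.asIdeal) →ₗ[R] (R ⧸ p.asIdeal))
      (Submodule.mkQ (x • (⊤ : Submodule R (R ⧸ p.asIdeal)))) := by
    intro a
    rw [Submodule.mkQ_apply, Submodule.Quotient.mk_eq_zero, Submodule.mem_smul_pointwise_iff_exists]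
    simp
  have hg := Submodule.mkQ_surjective (x • (⊤ : Submodule R (R ⧸ p.asIdeal)))
  let c := conn X hf hfg hg n (n + 1) rfl
  have hc : LinearMap.ker c = x • (⊤ : Submodule R (DExt X (R ⧸ p.asIdeal) n)) := by
    rw [(exact_pre_conn X hf hfg hg n (n + 1) rfl).linearMap_ker_eq]
    ext y
    rw [LinearMap.mem_range, Submodule.mem_smul_pointwise_iff_exists]
    simp [pre_smul, pre_id]
  have h₁ : q ∈ Module.support R (QuotSMulTop x (DExt X (R ⧸ p.asIdeal) n)) := by
    rw [Module.support_quotSMulTop]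
    exact ⟨Module.mem_support_mono hpq.le hp, by simpa using hxq⟩
  have h₂ := Module.support_subset_of_injective
    ((x • (⊤ : Submodule R (DExt X (R ⧸ p.asIdeal) n))).liftQ c hc.ge)
    (LinearMap.ker_eq_bot.mp (Submodule.ker_liftQ_eq_bot _ _ _ hc.le)) h₁
  obtain ⟨p', hp', h₃⟩ := exists_prime_of_mem_support X (n + 1) q
    (QuotSMulTop x (R ⧸ p.asIdeal)) h₂
  rw [Module.support_quotSMulTop, Module.support_eq_zeroLocus, Ideal.annihilator_quotient] at hp'
  obtain ⟨hp'₁, hp'₂⟩ := hp'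
  have hle := le_of_mem_support X (n + 1) p' q h₃
  have hlt : p < p' := lt_of_le_of_ne hp'₁ fun h => hxp (by rw [h]; simpa using hp'₂)
  obtain rfl : p' = q := by
    by_contra hne
    exact hpq.2 hlt (lt_of_le_of_ne hle hne)
  exact h₃

theorem maximalIdeal_mem_support [IsLocalRing R] (i₀ : ℤ) [X.IsGE i₀]
    (hX : ∀ n, IsNoetherian R (DExt X R n)) (d : ℕ) (n : ℤ) (p : PrimeSpectrum R)
    (hd : Order.coheight p = d) (hp : p ∈ Module.support R (DExt X (R ⧸ p.asIdeal) n)) :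
    IsLocalRing.closedPoint R ∈ Module.support R
      (DExt X (IsLocalRing.ResidueField R) (n + d)) := by
  induction d generalizing n p with
  | zero =>
    have : IsMax p := by simpa using hd
    obtain rfl : p = IsLocalRing.closedPoint R :=
      this.eq_of_le (IsLocalRing.le_maximalIdeal p.isPrime.ne_top)
    rw [Nat.cast_zero, add_zero]
    exact hp
  | succ d ih =>
    obtain ⟨q, hpq, hq⟩ := exists_covBy_of_coheight_eq (n := d) (by simpa using hd)
    have := isNoetherian X i₀ hX n (R ⧸ p.asIdeal)
    have := ih (n + 1) q hq (mem_support_of_covBy X n p q hpq inferInstance hp)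
    rwa [show n + ((d + 1 : ℕ) : ℤ) = n + 1 + d by push_cast; ring]

end DExt

end Bass

section Localization

variable {A : Type} [CommRing A] (p : Ideal A) [p.IsPrime]

/-- The canonical map from a module to its localization at a prime. -/
noncomputable def toExtendScalars (H : ModuleCat.{0} A) :
    H →+ (ModuleCat.extendScalars.{0,0,0} (algebraMap A (Localization.AtPrime p))).obj H :=
  (((ModuleCat.extendRestrictScalarsAdj.{0,0,0}
    (algebraMap A (Localization.AtPrime p))).unit.app H).hom).toAddMonoidHom

lemma toExtendScalars_smul (H : ModuleCat.{0} A) (a : A) (y : H) :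
    toExtendScalars p H (a • y) =
      algebraMap A (Localization.AtPrime p) a • toExtendScalars p H y :=
  (((ModuleCat.extendRestrictScalarsAdj.{0,0,0}
    (algebraMap A (Localization.AtPrime p))).unit.app H).hom).map_smul a y

lemma extendScalars_induction {H : ModuleCat.{0} A}
    {P : (ModuleCat.extendScalars.{0,0,0} (algebraMap A (Localization.AtPrime p))).obj H → Prop}
    (zero : P 0) (smul : ∀ (s : Localization.AtPrime p) (y : H), P (s • toExtendScalars p H y))
    (add : ∀ x y, P x → P y → P (x + y))
    (z : (ModuleCat.extendScalars.{0,0,0} (algebraMap A (Localization.AtPrime p))).obj H) :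
    P z := by
  induction z using TensorProduct.induction_on with
  | zero => exact zero
  | tmul s x =>
    convert smul s x using 1
    conv_lhs => rw [← mul_one (M := Localization.AtPrime p) s]
    rfl
  | add x y hx hy => exact add x y hx hy

lemma exists_smul_eq_toExtendScalars (H : ModuleCat.{0} A)
    (z : (ModuleCat.extendScalars.{0,0,0} (algebraMap A (Localization.AtPrime p))).obj H) :
    ∃ s ∉ p, ∃ y : H, algebraMap A (Localization.AtPrime p) s • z = toExtendScalars p H y := by
  induction z using extendScalars_induction with
  | zero => exact ⟨1, p.ne_top_iff_one.mp ‹p.IsPrime›.ne_top, 0, by simp⟩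
  | smul s' x =>
    obtain ⟨⟨a, s⟩, h⟩ := IsLocalization.surj p.primeCompl (S := Localization.AtPrime p) s'
    refine ⟨s, s.2, a • x, ?_⟩
    rw [toExtendScalars_smul, ← h, smul_smul, mul_comm]
  | add x y hx hy =>
    obtain ⟨s, hs, x', hx⟩ := hx
    obtain ⟨t, ht, y', hy⟩ := hy
    refine ⟨s * t, ‹p.IsPrime›.mul_notMem hs ht, t • x' + s • y', ?_⟩
    rw [map_add, toExtendScalars_smul, toExtendScalars_smul, ← hx, ← hy, smul_smul, smul_smul,
      ← map_mul, ← map_mul, mul_comm t s, smul_add]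

lemma toExtendScalars_eq_zero (H : ModuleCat.{0} A) (y : H) (hy : toExtendScalars p H y = 0) :
    ∃ s ∉ p, s • y = 0 := by
  let N : ModuleCat.{0} (Localization.AtPrime p) :=
    ModuleCat.of _ (LocalizedModule p.primeCompl H)
  let ψ : H ⟶ (ModuleCat.restrictScalars (algebraMap A (Localization.AtPrime p))).obj N :=
    ModuleCat.ofHom (Y := (ModuleCat.restrictScalars (algebraMap A (Localization.AtPrime p))).obj N)
      { toFun := fun x => LocalizedModule.mk x 1
        map_add' := fun x y => (LocalizedModule.mkLinearMap p.primeCompl H).map_add x y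
        map_smul' := fun a x => by
          refine ((LocalizedModule.mkLinearMap p.primeCompl H).map_smul a x).trans ?_
          exact (algebraMap_smul (Localization.AtPrime p) a
            (LocalizedModule.mkLinearMap p.primeCompl H x)).symm }
  let adj := ModuleCat.extendRestrictScalarsAdj.{0,0,0} (algebraMap A (Localization.AtPrime p))
  have h : adj.unit.app H ≫ (ModuleCat.restrictScalars _).map ((adj.homEquiv H N).symm ψ) = ψ := by
    exact (adj.homEquiv_unit _ _ _).symm.trans (Equiv.apply_symm_apply _ _)
  have h' : LocalizedModule.mk y (1 : p.primeCompl) = 0 := by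
    have h₁ : ψ.hom y = ((adj.homEquiv H N).symm ψ).hom (toExtendScalars p H y) := by
      conv_lhs => rw [← h]
      rfl
    rw [hy, map_zero] at h₁
    exact h₁
  obtain ⟨s, hs⟩ := (IsLocalizedModule.eq_zero_iff p.primeCompl
    (LocalizedModule.mkLinearMap p.primeCompl H)).mp h'
  exact ⟨s, s.2, hs⟩

/-- A nonzero element of the localization of a module killed by a finitely generated prime comes,
up to a unit, from an element killed by the prime. -/
lemma exists_of_extendScalars (hp : p.FG) (H : ModuleCat.{0} A)
    (z : (ModuleCat.extendScalars.{0,0,0} (algebraMap A (Localization.AtPrime p))).obj H)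
    (hz : z ≠ 0) (hpz : ∀ a ∈ p, algebraMap A (Localization.AtPrime p) a • z = 0) :
    ∃ y : H, (∀ a ∈ p, a • y = 0) ∧ ∀ s ∉ p, s • y ≠ 0 := by
  obtain ⟨s, hs, y, hy⟩ := exists_smul_eq_toExtendScalars p H z
  have hu (s : A) (hs : s ∉ p) (w) (h : algebraMap A (Localization.AtPrime p) s • w =
      (0 : (ModuleCat.extendScalars.{0,0,0} (algebraMap A (Localization.AtPrime p))).obj H)) :
      w = 0 :=
    (IsLocalization.map_units (Localization.AtPrime p) (⟨s, hs⟩ : p.primeCompl)).smul_eq_zero.mp h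
  obtain ⟨T, hT⟩ := hp
  have hTp (a) (ha : a ∈ T) : a ∈ p := hT ▸ Ideal.subset_span ha
  have key (a : A) (ha : a ∈ p) : ∃ t ∉ p, t • a • y = 0 := by
    refine toExtendScalars_eq_zero p H _ ?_
    rw [toExtendScalars_smul, ← hy, smul_comm, hpz a ha, smul_zero]
  choose! t ht hty using key
  have hprod : ∏ a ∈ T, t a ∉ p := by
    rw [‹p.IsPrime›.prod_mem_iff]
    rintro ⟨a, ha, h⟩
    exact ht a (hTp a ha) h
  refine ⟨(∏ a ∈ T, t a) • y, fun a ha => ?_, fun u hu' h => ?_⟩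
  · suffices p ≤ LinearMap.ker (LinearMap.toSpanSingleton A H ((∏ a ∈ T, t a) • y)) from
      this ha
    conv_lhs => rw [← hT]
    rw [Ideal.span_le]
    intro a ha
    obtain ⟨c, hc⟩ := Finset.dvd_prod_of_mem t ha
    change a • (∏ a ∈ T, t a) • y = 0
    rw [hc, smul_comm, mul_comm, mul_smul, hty a (hTp a ha), smul_zero]
  · rw [smul_smul] at h
    have h₁ : toExtendScalars p H ((u * ∏ a ∈ T, t a) • y) = 0 := by rw [h, map_zero]
    rw [toExtendScalars_smul, ← hy] at h₁
    exact hz (hu s hs _ (hu _ (‹p.IsPrime›.mul_notMem hu' hprod) _ h₁))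

end Localization

section AssociatedPrime

variable {A : Type} [CommRing A]

/-- Flat extension of scalars commutes with homology. -/
noncomputable def homologyExtendScalarsIso {S : Type} [CommRing S] {f : A →+* S} (hf : f.Flat)
    (M : CochainComplex (ModuleCat A) ℤ) (i : ℤ) :
    (((ModuleCat.extendScalars.{0,0,0} f).mapHomologicalComplex (ComplexShape.up ℤ)).obj
      M).homology i ≅ (ModuleCat.extendScalars.{0,0,0} f).obj (M.homology i) :=
  have := ModuleCat.preservesFiniteLimits_extendScalars_of_flat hf
  have : (ModuleCat.extendScalars.{0,0,0} f).IsLeftAdjoint :=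
    ⟨_, ⟨ModuleCat.extendRestrictScalarsAdj.{0,0,0} f⟩⟩
  have := (ModuleCat.extendScalars.{0,0,0} f).preservesHomologyOfExact
  (M.sc i).mapHomologyIso (ModuleCat.extendScalars.{0,0,0} f)

lemma isGE_Q_of_isZero_homology {R : Type} [CommRing R] [HasDerivedCategory.{w} (ModuleCat R)]
    (M : CochainComplex (ModuleCat R) ℤ) (i₀ : ℤ) (h : ∀ i < i₀, IsZero (M.homology i)) :
    (DerivedCategory.Q.obj M).IsGE i₀ := by
  rw [DerivedCategory.isGE_Q_obj_iff, CochainComplex.isGE_iff]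
  intro i hi
  exact (HomologicalComplex.exactAt_iff_isZero_homology _ _).mpr (h i hi)

variable [IsNoetherianRing A] [HasDerivedCategory.{w} (ModuleCat A)]

lemma mem_support_dext_of_homology (M : CochainComplex (ModuleCat A) ℤ) (i₀ : ℤ)
    (hM : ∀ i < i₀, IsZero (M.homology i)) (p : PrimeSpectrum A) (y : M.homology i₀)
    (hy : ∀ a ∈ p.asIdeal, a • y = 0) (hys : ∀ s ∉ p.asIdeal, s • y ≠ 0) :
    p ∈ Module.support A (DExt (DerivedCategory.Q.obj M) (A ⧸ p.asIdeal) i₀) := by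
  have := isGE_Q_of_isZero_homology M i₀ hM
  set X := DerivedCategory.Q.obj M
  let e := homologyEquivDExt M i₀
  have h₀ : DExt.pre X p.asIdeal.subtype i₀ (e y) = 0 := by
    refine DExt.eq_zero_of_forall_pre_eq_zero X i₀ _ _ fun h => ?_
    rw [← DExt.pre_comp]
    have : p.asIdeal.subtype ∘ₗ h = (h 1 : A) • LinearMap.id := by ext; simp
    rw [this, DExt.pre_smul, DExt.pre_id, ← map_smul, hy _ (h 1).2, map_zero]
  obtain ⟨f, hf⟩ := (DExt.exact_pre X (Submodule.subtype_injective p.asIdeal)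
    (LinearMap.exact_subtype_mkQ p.asIdeal) (Submodule.mkQ_surjective _) i₀ (e y)).mp h₀
  refine Module.mem_support_iff'.mpr ⟨f, fun s hs h => hys s hs (e.injective ?_)⟩
  rw [map_smul, ← hf, ← map_smul, h, map_zero, map_zero]

lemma mem_support_dext_of_localization (M : CochainComplex (ModuleCat A) ℤ) (i₀ : ℤ)
    (hM : ∀ i < i₀, IsZero (M.homology i)) (p : Ideal A) [hp : p.IsPrime]
    [HasDerivedCategory.{w₁} (ModuleCat (Localization.AtPrime p))]
    (g : DExt (DerivedCategory.Q.obj (((ModuleCat.extendScalars.{0,0,0}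
      (algebraMap A (Localization.AtPrime p))).mapHomologicalComplex
        (ComplexShape.up ℤ)).obj M)) (Localization.AtPrime p ⧸
          p.map (algebraMap A (Localization.AtPrime p))) i₀) (hg : g ≠ 0) :
    (⟨p, hp⟩ : PrimeSpectrum A) ∈
      Module.support A (DExt (DerivedCategory.Q.obj M) (A ⧸ p) i₀) := by
  have hflat : (algebraMap A (Localization.AtPrime p)).Flat :=
    (RingHom.flat_algebraMap_iff).mpr (IsLocalization.flat _ p.primeCompl)
  have := isGE_Q_of_isZero_homology (((ModuleCat.extendScalars.{0,0,0}
    (algebraMap A (Localization.AtPrime p))).mapHomologicalComplex (ComplexShape.up ℤ)).obj M) i₀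
    fun i hi => ((ModuleCat.extendScalars.{0,0,0} _).map_isZero (hM i hi)).of_iso
      (homologyExtendScalarsIso hflat M i)
  let e := (homologyEquivDExt (((ModuleCat.extendScalars.{0,0,0}
    (algebraMap A (Localization.AtPrime p))).mapHomologicalComplex
      (ComplexShape.up ℤ)).obj M) i₀).symm ≪≫ₗ (homologyExtendScalarsIso hflat M i₀).toLinearEquiv
  let u := DExt.pre (DerivedCategory.Q.obj (((ModuleCat.extendScalars.{0,0,0}
    (algebraMap A (Localization.AtPrime p))).mapHomologicalComplex (ComplexShape.up ℤ)).obj M))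
    (p.map (algebraMap A (Localization.AtPrime p))).mkQ i₀
  have hu : Function.Injective u :=
    DExt.pre_injective_of_surjective _ i₀ (Submodule.mkQ_surjective _)
  obtain ⟨y, hy, hys⟩ := exists_of_extendScalars p (IsNoetherian.noetherian p) (M.homology i₀)
    (e (u g)) (fun h => hg (hu (e.injective (by rw [h, map_zero, map_zero]))))
    (fun a ha => by
      rw [← map_smul, ← map_smul, DExt.smul_eq_zero_of_mem _ _ _ _ _
        (Ideal.mem_map_of_mem _ ha), map_zero, map_zero])
  exact mem_support_dext_of_homology M i₀ hM ⟨p, hp⟩ y hy hys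

end AssociatedPrime

/-- **Paper's Theorem 4.7 (ring base):** if `(A, m)` is a commutative noetherian local
ring, `M ≠ 0` a cohomologically bounded-below complex of `A`-modules with finitely
generated cohomology, `i₀ = inf(M)`, and `p` is an associated prime of `M` lying in
the support of `H^{i₀}(M)` (i.e. `H^{i₀}(M)_p ≠ 0` and
`Ext^{i₀}_{A_p}(A_p/pA_p, M_p) ≠ 0`), then `Ext^{i₀ + dim(A/p)}_A(A/m, M) ≠ 0`. -/
theorem stmt_6
    (A : Type) [CommRing A] [IsNoetherianRing A] [IsLocalRing A]
    [HasDerivedCategory (ModuleCat A)]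
    (M : CochainComplex (ModuleCat A) ℤ)
    (hMfg : ∀ i : ℤ, Module.Finite A (M.homology i))
    (i₀ : ℤ)
    (hinf : ¬ IsZero (M.homology i₀))
    (hbelow : ∀ i < i₀, IsZero (M.homology i))
    (p : Ideal A) (hp : p.IsPrime)
    (hsupp : (⟨p, hp⟩ : PrimeSpectrum A) ∈ Module.support A (M.homology i₀))
    [HasDerivedCategory (ModuleCat (Localization.AtPrime p))]
    (hass : ∃ g : (DerivedCategory.singleFunctor (ModuleCat (Localization.AtPrime p)) 0).obj
          (ModuleCat.of (Localization.AtPrime p)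
            (Localization.AtPrime p ⧸ p.map (algebraMap A (Localization.AtPrime p)))) ⟶
        (DerivedCategory.Q.obj
          (((ModuleCat.extendScalars.{0,0,0}
              (algebraMap A (Localization.AtPrime p))).mapHomologicalComplex
                (ComplexShape.up ℤ)).obj M))⟦i₀⟧, g ≠ 0)
    (d : ℕ) (hdim : ringKrullDim (A ⧸ p) = d) :
    ∃ f : (DerivedCategory.singleFunctor (ModuleCat A) 0).obj
        (ModuleCat.of A (IsLocalRing.ResidueField A)) ⟶
        (DerivedCategory.Q.obj M)⟦i₀ + (d : ℤ)⟧, f ≠ 0 := by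
  have := isGE_Q_of_isZero_homology M i₀ hbelow
  obtain ⟨g, hg⟩ := hass
  have hX (n : ℤ) : IsNoetherian A (DExt (DerivedCategory.Q.obj M) A n) :=
    isNoetherian_of_linearEquiv (homologyEquivDExt M n)
  have hd : Order.coheight (⟨p, hp⟩ : PrimeSpectrum A) = d := by
    rw [ringKrullDim_quotient] at hdim
    have h : (Order.coheight (⟨p, hp⟩ : PrimeSpectrum A) : WithBot ℕ∞) = (d : ℕ∞) := by
      rw [Order.coheight_eq_krullDim_Ici]
      exact hdim
    exact_mod_cast h
  obtain ⟨f, hf⟩ := Module.mem_support_iff'.mp (DExt.maximalIdeal_mem_support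
    (DerivedCategory.Q.obj M) i₀ hX d i₀ ⟨p, hp⟩ hd
      (mem_support_dext_of_localization M i₀ hbelow p g hg))
  exact ⟨f, fun h => hf 1 ((Ideal.ne_top_iff_one _).mp Ideal.IsPrime.ne_top')
    (by rw [h, smul_zero])⟩
end

section
/- Let (A, m) be a commutative noetherian local ring, let M be a nonzero cohomologically bounded-below complex of A-modules all of whose cohomology modules are finitely generated, and let I ⊆ m be a proper ideal. Then the maximal length of an M-regular sequence consisting of elements of I is finite and equals depth_A(I, M) − inf(M); that is, seq.depth_A(I, M) = depth_A(I, M) − inf(M). -/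
open CategoryTheory Limits

/-- A finite sequence `x_1, …, x_k` of elements of `A` is `M`-regular (for a complex `M`
of `A`-modules) if `x_1` acts injectively on `H^{inf(M)}(M)` and `x_2, …, x_k` is a
regular sequence on the mapping cone of multiplication by `x_1` on `M`. -/
noncomputable def IsRegSeq (A : Type) [CommRing A] :
    CochainComplex (ModuleCat A) ℤ → List A → Prop
  | _, [] => True
  | M, x :: xs =>
      (Function.Injective
        (fun y : ↥(M.homology (sInf {i : ℤ | ¬ IsZero (M.homology i)})) => x • y))
      ∧ IsRegSeq A (CochainComplex.mappingCone (x • 𝟙 M)) xs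

namespace DerivedCategory

universe w v u

variable {C : Type u} [Category.{v} C] [Abelian C] [HasDerivedCategory.{w} C]

/-- A nonzero morphism `B ⟶ H⁰(X)` with `X ∈ D^{≥ 0}` gives a nonzero morphism `B ⟶ X`. -/
lemma exists_single_hom_ne_zero (X : DerivedCategory C) [X.IsGE 0] {B : C}
    (φ : B ⟶ (homologyFunctor C 0).obj X) (hφ : φ ≠ 0) :
    ∃ f : (singleFunctor C 0).obj B ⟶ X, f ≠ 0 := by
  obtain ⟨K, hK, ⟨e⟩⟩ := X.exists_iso_Q_obj_of_isGE 0
  have hd : K.d (-1) 0 = 0 := (K.isZero_of_isStrictlyGE 0 (-1) (by lia)).eq_of_src _ _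
  have hπ : IsIso (K.homologyπ 0) := K.isIso_homologyπ (-1) 0 (by simp) hd
  let ε : (homologyFunctor C 0).obj X ≅ K.homology 0 :=
    (homologyFunctor C 0).mapIso e ≪≫ (homologyFunctorFactors C 0).app K
  let ψ : B ⟶ K.X 0 := φ ≫ ε.hom ≫ inv (K.homologyπ 0) ≫ K.iCycles 0
  have hψ : ψ ≠ 0 := fun h ↦ hφ (by
    rw [← cancel_mono (ε.hom ≫ inv (K.homologyπ 0) ≫ K.iCycles 0), zero_comp]
    exact h)
  let g : (HomologicalComplex.single C (.up ℤ) 0).obj B ⟶ K :=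
    HomologicalComplex.mkHomFromSingle ψ (by simp [ψ])
  have hg : HomologicalComplex.homologyMap g 0 ≠ 0 := fun h ↦ hψ (by
    have h₁ : HomologicalComplex.cyclesMap g 0 = 0 := by
      rw [← cancel_mono (K.homologyπ 0), ← HomologicalComplex.homologyπ_naturality, h]
      simp
    have h₂ : g.f 0 = 0 := by
      have := HomologicalComplex.cyclesMap_i g 0
      have hi : IsIso (((HomologicalComplex.single C (.up ℤ) 0).obj B).iCycles 0) :=
        HomologicalComplex.isIso_iCycles _ 0 1 (by simp) (by simp)
      rw [h₁, zero_comp] at this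
      rw [← cancel_epi (((HomologicalComplex.single C (.up ℤ) 0).obj B).iCycles 0), ← this,
        comp_zero]
    rw [HomologicalComplex.mkHomFromSingle_f] at h₂
    simpa using h₂)
  refine ⟨Q.map g ≫ e.inv, fun h ↦ hg ?_⟩
  have h₀ : Q.map g = 0 := by rwa [← cancel_mono e.inv, zero_comp]
  have := homologyFunctorFactors_hom_naturality g 0
  rw [h₀, Functor.map_zero, zero_comp] at this
  exact (cancel_epi ((homologyFunctorFactors C 0).hom.app _)).1 (this.symm.trans comp_zero.symm)

lemma exists_single_hom_shift_ne_zero (K : CochainComplex C ℤ) (n : ℤ)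
    (hK : ∀ i < n, IsZero (K.homology i)) {B : C} (φ : B ⟶ K.homology n) (hφ : φ ≠ 0) :
    ∃ f : (singleFunctor C 0).obj B ⟶ (Q.obj K)⟦n⟧, f ≠ 0 := by
  have hGE : (Q.obj K).IsGE n := by
    rw [isGE_Q_obj_iff, CochainComplex.isGE_iff]
    intro i hi
    rw [HomologicalComplex.exactAt_iff_isZero_homology]
    exact hK i hi
  have : ((Q.obj K)⟦n⟧).IsGE 0 := TStructure.t.isGE_shift (Q.obj K) n n 0
  let ε : (homologyFunctor C 0).obj ((Q.obj K)⟦n⟧) ≅ K.homology n :=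
    ((homologyFunctor C 0).shiftIso n 0 n (by lia)).app (Q.obj K) ≪≫
      (homologyFunctorFactors C n).app K
  refine exists_single_hom_ne_zero _ (φ ≫ ε.inv) fun h ↦ hφ ?_
  rwa [← cancel_mono ε.inv, zero_comp]

lemma single_hom_shift_eq_zero (K : CochainComplex C ℤ) (n m : ℤ) (hm : m < n)
    (hK : ∀ i < n, IsZero (K.homology i)) {B : C}
    (f : (singleFunctor C 0).obj B ⟶ (Q.obj K)⟦m⟧) : f = 0 := by
  have hGE : (Q.obj K).IsGE n := by
    rw [isGE_Q_obj_iff, CochainComplex.isGE_iff]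
    intro i hi
    rw [HomologicalComplex.exactAt_iff_isZero_homology]
    exact hK i hi
  have : ((Q.obj K)⟦m⟧).IsGE (n - m) := TStructure.t.isGE_shift (Q.obj K) n m (n - m)
  exact TStructure.t.zero f 0 (n - m) (by lia)

variable {R : Type*} [CommRing R] [Linear R C]

/-- If `x` annihilates `B`, then multiplication by `x` kills every morphism from `B`. -/
lemma single_hom_comp_smul_id_shift {B : C} {x : R} (hx : x • 𝟙 B = 0) (X : DerivedCategory C)
    (n : ℤ) (f : (singleFunctor C 0).obj B ⟶ X⟦n⟧) : f ≫ (x • 𝟙 X)⟦n⟧' = 0 := by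
  have h : x • 𝟙 ((singleFunctor C 0).obj B) = 0 := by
    rw [← CategoryTheory.Functor.map_id, ← Functor.map_smul, hx, Functor.map_zero]
  rw [Functor.map_smul, CategoryTheory.Functor.map_id, Linear.comp_smul, Category.comp_id,
    ← Category.id_comp f, ← Linear.smul_comp, h, zero_comp]

/-- If `x` annihilates `B`, every morphism `B ⟶ X⟦n + 1⟧` factors through the connecting
morphism of a distinguished triangle on multiplication by `x : X ⟶ X`, and a morphism to the
shifted cone which is killed by that connecting morphism comes from `X⟦n⟧`. -/
lemma exists_connecting_hom_of_distTriang {B : C} {x : R} (hx : x • 𝟙 B = 0)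
    {X Y : DerivedCategory C} {f : X ⟶ X} (hf : f = x • 𝟙 X) {v : X ⟶ Y} {w : Y ⟶ X⟦(1 : ℤ)⟧}
    (hT : Pretriangulated.Triangle.mk f v w ∈ Pretriangulated.distinguishedTriangles) (n : ℤ) :
    ∃ δ : Y⟦n⟧ ⟶ X⟦n + 1⟧,
      (∀ f : (singleFunctor C 0).obj B ⟶ X⟦n + 1⟧, ∃ g, f = g ≫ δ) ∧
      (∀ g : (singleFunctor C 0).obj B ⟶ Y⟦n⟧, g ≫ δ = 0 →
        ∃ (h : (singleFunctor C 0).obj B ⟶ X⟦n⟧) (α : X⟦n⟧ ⟶ Y⟦n⟧), g = h ≫ α) := by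
  subst hf
  obtain ⟨α, β, hT'⟩ : ∃ (α : X⟦n⟧ ⟶ Y⟦n⟧) (β : Y⟦n⟧ ⟶ X⟦n⟧⟦(1 : ℤ)⟧),
      Pretriangulated.Triangle.mk (n.negOnePow • (x • 𝟙 X)⟦n⟧') α β ∈
        Pretriangulated.distinguishedTriangles :=
    ⟨_, _, Pretriangulated.Triangle.shift_distinguished _ hT n⟩
  let e : X⟦n + 1⟧ ≅ X⟦n⟧⟦(1 : ℤ)⟧ :=
    (shiftFunctorAdd' (DerivedCategory C) n 1 (n + 1) rfl).app X
  have he : e.hom ≫ (x • 𝟙 X)⟦n⟧'⟦(1 : ℤ)⟧' = (x • 𝟙 X)⟦n + 1⟧' ≫ e.hom :=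
    ((shiftFunctorAdd' (DerivedCategory C) n 1 (n + 1) rfl).hom.naturality _).symm
  refine ⟨β ≫ e.inv, fun f ↦ ?_, fun g hg ↦ ?_⟩
  · obtain ⟨g, hg⟩ := Pretriangulated.Triangle.coyoneda_exact₁ _ hT' (f ≫ e.hom) (by
      change (f ≫ e.hom) ≫ (n.negOnePow • (x • 𝟙 X)⟦n⟧')⟦(1 : ℤ)⟧' = 0
      rw [Functor.map_units_smul, Linear.comp_units_smul, Category.assoc, he, ← Category.assoc,
        single_hom_comp_smul_id_shift hx X (n + 1) f, zero_comp, smul_zero])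
    exact ⟨g, ((Iso.eq_comp_inv e).2 hg).trans (Category.assoc _ _ _)⟩
  · obtain ⟨h, hh⟩ := Pretriangulated.Triangle.coyoneda_exact₃ _ hT' g (by
      change g ≫ β = 0
      rw [← cancel_mono e.inv, Category.assoc, hg, zero_comp])
    exact ⟨h, α, hh⟩

lemma exists_connecting_hom (K : CochainComplex C ℤ) {B : C} {x : R} (hx : x • 𝟙 B = 0) (n : ℤ) :
    ∃ δ : (Q.obj (CochainComplex.mappingCone (x • 𝟙 K)))⟦n⟧ ⟶ (Q.obj K)⟦n + 1⟧,
      (∀ f : (singleFunctor C 0).obj B ⟶ (Q.obj K)⟦n + 1⟧, ∃ g, f = g ≫ δ) ∧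
      (∀ g : (singleFunctor C 0).obj B ⟶ _, g ≫ δ = 0 →
        ∃ (h : (singleFunctor C 0).obj B ⟶ (Q.obj K)⟦n⟧) (α : _ ⟶ _), g = h ≫ α) :=
  exists_connecting_hom_of_distTriang hx
    ((Q.map_smul x (𝟙 K)).trans (congrArg (x • ·) (Q.map_id K)))
    (mappingCone_triangle_distinguished (x • 𝟙 K)) n

end DerivedCategory

namespace CochainComplex

variable {A : Type} [CommRing A] (M : CochainComplex (ModuleCat A) ℤ) (x : A)

lemma homologyMap_smul_id_apply (i : ℤ) (y : M.homology i) :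
    HomologicalComplex.homologyMap (x • 𝟙 M) i y = x • y := by
  have h : HomologicalComplex.homologyMap (x • 𝟙 M) i = x • 𝟙 (M.homology i) :=
    (ShortComplex.homologyMap_smul (𝟙 (M.sc i)) x).trans
      (congrArg (x • ·) (ShortComplex.homologyMap_id (M.sc i)))
  rw [h]
  rfl

/-- The long exact homology sequence of the mapping cone of multiplication by `x`. -/
lemma exists_homology_exact_mappingCone_smul (i : ℤ) :
    ∃ (α : M.homology i →ₗ[A] (mappingCone (x • 𝟙 M)).homology i)
      (δ : (mappingCone (x • 𝟙 M)).homology i →ₗ[A] M.homology (i + 1)),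
      Function.Exact (fun y : M.homology i ↦ x • y) α ∧ Function.Exact α δ ∧
        Function.Exact δ (fun y : M.homology (i + 1) ↦ x • y) := by
  let _ := HasDerivedCategory.standard (ModuleCat A)
  have hT := DerivedCategory.mappingCone_triangle_distinguished (x • 𝟙 M)
  have h₂ := homologyMap_exact₂_of_distTriang _ hT i
  have h₃ := homologyMap_exact₃_of_distTriang _ hT i (i + 1)
  have h₁ := homologyMap_exact₁_of_distTriang _ hT i (i + 1)
  rw [ShortComplex.ShortExact.moduleCat_exact_iff_function_exact] at h₁ h₂ h₃
  refine ⟨(HomologicalComplex.homologyMap (mappingCone.triangle (x • 𝟙 M)).mor₂ i).hom,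
    (homologyδOfTriangle (mappingCone.triangle (x • 𝟙 M)) i (i + 1)).hom, ?_, h₃, ?_⟩
  · have h : (fun y : M.homology i ↦ x • y) = HomologicalComplex.homologyMap (x • 𝟙 M) i :=
      funext fun y ↦ (homologyMap_smul_id_apply M x i y).symm
    rw [h]
    exact h₂
  · have h : (fun y : M.homology (i + 1) ↦ x • y) =
        HomologicalComplex.homologyMap (x • 𝟙 M) (i + 1) :=
      funext fun y ↦ (homologyMap_smul_id_apply M x (i + 1) y).symm
    rw [h]
    exact h₁

/-- The ideal of elements acting nilpotently on each cohomology module of `M`. -/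
noncomputable def nilIdeal : Ideal A :=
  ⨅ i : ℤ, (Module.annihilator A (M.homology i)).radical

variable {M} in
lemma mem_nilIdeal {y : A} :
    y ∈ nilIdeal M ↔ ∀ i : ℤ, ∃ n : ℕ, ∀ z : M.homology i, y ^ n • z = 0 := by
  simp only [nilIdeal, Ideal.mem_iInf, Ideal.mem_radical_iff, Module.mem_annihilator]

lemma nilIdeal_le_mappingCone_smul : nilIdeal M ≤ nilIdeal (mappingCone (x • 𝟙 M)) := by
  intro y hy
  rw [mem_nilIdeal] at hy ⊢
  intro i
  obtain ⟨α, δ, -, h, -⟩ := exists_homology_exact_mappingCone_smul M x i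
  obtain ⟨a, ha⟩ := hy i
  obtain ⟨b, hb⟩ := hy (i + 1)
  refine ⟨a + b, fun z ↦ ?_⟩
  obtain ⟨w, hw⟩ := (h (y ^ b • z)).1 (by rw [map_smul, hb])
  rw [pow_add, mul_smul, ← hw, ← map_smul, ha, map_zero]

lemma mem_nilIdeal_mappingCone_smul : x ∈ nilIdeal (mappingCone (x • 𝟙 M)) := by
  rw [mem_nilIdeal]
  intro i
  obtain ⟨α, δ, h₁, h₂, h₃⟩ := exists_homology_exact_mappingCone_smul M x i
  refine ⟨2, fun z ↦ ?_⟩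
  obtain ⟨w, hw⟩ := (h₂ (x • z)).1 (by rw [map_smul]; exact (h₃ _).2 ⟨z, rfl⟩)
  rw [pow_two, mul_smul, ← hw, ← map_smul]
  exact (h₁ _).2 ⟨w, rfl⟩

variable {M x}

lemma not_mem_nilIdeal {i : ℤ} (hi : ¬ IsZero (M.homology i))
    (hx : IsSMulRegular (M.homology i) x) : x ∉ nilIdeal M := by
  intro h
  obtain ⟨n, hn⟩ := mem_nilIdeal.1 h i
  refine hi (ModuleCat.isZero_iff_subsingleton.2 ⟨fun a b ↦ hx.pow n ?_⟩)
  simp only [hn]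

lemma isZero_homology_mappingCone_smul {i₀ : ℤ} (hM : ∀ i < i₀, IsZero (M.homology i))
    (hx : IsSMulRegular (M.homology i₀) x) (i : ℤ) (hi : i < i₀) :
    IsZero ((mappingCone (x • 𝟙 M)).homology i) := by
  obtain ⟨α, δ, h₁, h₂, h₃⟩ := exists_homology_exact_mappingCone_smul M x i
  have hreg : IsSMulRegular (M.homology (i + 1)) x := by
    obtain h | rfl : i + 1 < i₀ ∨ i + 1 = i₀ := by lia
    · have := ModuleCat.subsingleton_of_isZero (hM _ h)
      exact fun _ _ _ ↦ Subsingleton.elim _ _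
    · exact hx
  have hs := ModuleCat.subsingleton_of_isZero (hM i hi)
  refine ModuleCat.isZero_iff_subsingleton.2 (subsingleton_of_forall_eq 0 fun y ↦ ?_)
  have hy : δ y = 0 := hreg (by
    have : x • δ y = 0 := (h₃ _).2 ⟨y, rfl⟩
    exact this.trans (smul_zero x).symm)
  obtain ⟨z, rfl⟩ := (h₂ y).1 hy
  rw [Subsingleton.elim z 0, map_zero]

lemma not_isZero_homology_mappingCone_smul [IsLocalRing A] {i : ℤ}
    (hx : x ∈ IsLocalRing.maximalIdeal A) [Module.Finite A (M.homology i)]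
    (hi : ¬ IsZero (M.homology i)) : ¬ IsZero ((mappingCone (x • 𝟙 M)).homology i) := by
  intro h
  obtain ⟨α, δ, h₁, -, -⟩ := exists_homology_exact_mappingCone_smul M x i
  have := ModuleCat.subsingleton_of_isZero h
  apply hi
  have htop : (⊤ : Submodule A (M.homology i)) = ⊥ := by
    refine Submodule.eq_bot_of_le_smul_of_le_jacobson_bot (IsLocalRing.maximalIdeal A) _
      Module.Finite.fg_top (fun y _ ↦ ?_) (IsLocalRing.maximalIdeal_le_jacobson _)
    obtain ⟨w, rfl⟩ := (h₁ y).1 (Subsingleton.elim _ _)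
    exact Submodule.smul_mem_smul hx trivial
  exact ModuleCat.isZero_iff_subsingleton.2
    ((Submodule.subsingleton_iff A).1 (subsingleton_of_bot_eq_top htop.symm))

lemma finite_homology_mappingCone_smul [IsNoetherianRing A]
    (hM : ∀ i, Module.Finite A (M.homology i)) (i : ℤ) :
    Module.Finite A ((mappingCone (x • 𝟙 M)).homology i) := by
  obtain ⟨α, δ, -, h₂, -⟩ := exists_homology_exact_mappingCone_smul M x i
  have := hM i
  have := hM (i + 1)
  have := isNoetherian_of_range_eq_ker α δ (LinearMap.exact_iff.1 h₂).symm
  infer_instance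

lemma sInf_eq {i₀ : ℤ} (hinf : ¬ IsZero (M.homology i₀))
    (hbelow : ∀ i < i₀, IsZero (M.homology i)) :
    sInf {i : ℤ | ¬ IsZero (M.homology i)} = i₀ :=
  IsLeast.csInf_eq ⟨hinf, fun i hi ↦ not_lt.1 fun h ↦ hi (hbelow i h)⟩

lemma isRegSeq_cons {i₀ : ℤ} (hinf : ¬ IsZero (M.homology i₀))
    (hbelow : ∀ i < i₀, IsZero (M.homology i)) (xs : List A) :
    IsRegSeq A M (x :: xs) ↔
      IsSMulRegular (M.homology i₀) x ∧ IsRegSeq A (mappingCone (x • 𝟙 M)) xs := by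
  have key : ∀ j, j = i₀ → (Function.Injective (fun y : M.homology j ↦ x • y) ↔
      IsSMulRegular (M.homology i₀) x) := by
    rintro _ rfl
    rfl
  exact and_congr (key _ (sInf_eq hinf hbelow)) Iff.rfl

end CochainComplex

section

open DerivedCategory

variable {A : Type} [CommRing A]

lemma smul_id_quotient_eq_zero {I : Ideal A} {x : A} (hx : x ∈ I) :
    x • 𝟙 (ModuleCat.of A (A ⧸ I)) = 0 := by
  refine ModuleCat.hom_ext (LinearMap.ext fun y ↦ ?_)
  obtain ⟨a, rfl⟩ := Ideal.Quotient.mk_surjective y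
  change x • Ideal.Quotient.mk I a = 0
  rw [Algebra.smul_def, Ideal.Quotient.algebraMap_eq, Ideal.Quotient.eq_zero_iff_mem.2 hx,
    zero_mul]

variable [HasDerivedCategory (ModuleCat A)]

/-- The degrees in which `Ext_A(A/I, M)` does not vanish. -/
abbrev extSupport (I : Ideal A) (M : CochainComplex (ModuleCat A) ℤ) : Set ℤ :=
  {n : ℤ | ∃ f : (singleFunctor (ModuleCat A) 0).obj (ModuleCat.of A (A ⧸ I)) ⟶
    (Q.obj M)⟦n⟧, f ≠ 0}

variable {I : Ideal A} {M : CochainComplex (ModuleCat A) ℤ} {x : A}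

lemma add_one_mem_lowerBounds_extSupport (hx : x ∈ I) {e : ℤ}
    (h : e ∈ lowerBounds (extSupport I (CochainComplex.mappingCone (x • 𝟙 M)))) :
    e + 1 ∈ lowerBounds (extSupport I M) := by
  rintro n ⟨f, hf⟩
  obtain ⟨n, rfl⟩ : ∃ m, n = m + 1 := ⟨n - 1, by lia⟩
  obtain ⟨δ, h₁, -⟩ := exists_connecting_hom (R := A) M
    (B := ModuleCat.of A (A ⧸ I)) (smul_id_quotient_eq_zero hx) n
  obtain ⟨g, rfl⟩ := h₁ f
  have := h ⟨g, fun hg ↦ hf (by rw [hg, zero_comp])⟩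
  lia

lemma isLeast_extSupport_add_one (hx : x ∈ I) {e : ℤ}
    (h : IsLeast (extSupport I (CochainComplex.mappingCone (x • 𝟙 M))) e) :
    IsLeast (extSupport I M) (e + 1) := by
  have hlb := add_one_mem_lowerBounds_extSupport hx h.2
  refine ⟨?_, hlb⟩
  obtain ⟨g, hg⟩ := h.1
  obtain ⟨δ, -, h₂⟩ := exists_connecting_hom (R := A) M
    (B := ModuleCat.of A (A ⧸ I)) (smul_id_quotient_eq_zero hx) e
  refine ⟨g ≫ δ, fun h₀ ↦ ?_⟩
  obtain ⟨k, α, rfl⟩ := h₂ g h₀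
  have := hlb ⟨k, fun hk ↦ hg (by rw [hk, zero_comp])⟩
  lia

/-- A regular sequence of length `k` forces `Ext^n(A/I, M)` to vanish for `n < inf(M) + k`. -/
lemma add_length_mem_lowerBounds_extSupport [IsNoetherianRing A] [IsLocalRing A]
    (hI : I ≤ IsLocalRing.maximalIdeal A) {i₀ : ℤ} (xs : List A) (hxs : ∀ x ∈ xs, x ∈ I)
    (hMfg : ∀ i : ℤ, Module.Finite A (M.homology i)) (hinf : ¬ IsZero (M.homology i₀))
    (hbelow : ∀ i < i₀, IsZero (M.homology i)) (hreg : IsRegSeq A M xs) :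
    i₀ + xs.length ∈ lowerBounds (extSupport I M) := by
  induction xs generalizing M with
  | nil =>
    rintro n ⟨f, hf⟩
    by_contra! hn
    exact hf (single_hom_shift_eq_zero M i₀ n (by simpa using hn) hbelow f)
  | cons x xs ih =>
    have hx : x ∈ I := hxs x (by simp)
    obtain ⟨hreg, hreg'⟩ := (CochainComplex.isRegSeq_cons hinf hbelow xs).1 hreg
    have := hMfg i₀
    rw [List.length_cons, Nat.cast_add, Nat.cast_one, ← add_assoc]
    exact add_one_mem_lowerBounds_extSupport hx (ih (fun y hy ↦ hxs y (by simp [hy]))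
      (CochainComplex.finite_homology_mappingCone_smul hMfg)
      (CochainComplex.not_isZero_homology_mappingCone_smul (hI hx) hinf)
      (CochainComplex.isZero_homology_mappingCone_smul hbelow hreg) hreg')

lemma isLeast_extSupport_of_forall_not_isSMulRegular [IsNoetherianRing A] {i₀ : ℤ}
    [Module.Finite A (M.homology i₀)] (hbelow : ∀ i < i₀, IsZero (M.homology i))
    (h : ∀ x ∈ I, ¬ IsSMulRegular (M.homology i₀) x) : IsLeast (extSupport I M) i₀ := by
  constructor
  · have hns : ¬ Subsingleton ((A ⧸ I) →ₗ[A] M.homology i₀) := by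
      rw [IsSMulRegular.subsingleton_linearMap_iff, Ideal.annihilator_quotient]
      rintro ⟨r, hr, hr'⟩
      exact h r hr hr'
    rw [not_subsingleton_iff_nontrivial] at hns
    obtain ⟨φ, hφ⟩ := exists_ne (0 : (A ⧸ I) →ₗ[A] M.homology i₀)
    refine exists_single_hom_shift_ne_zero M i₀ hbelow (ModuleCat.ofHom φ) fun h₀ ↦ hφ ?_
    exact congrArg ModuleCat.Hom.hom h₀
  · rintro n ⟨f, hf⟩
    by_contra! hn
    exact hf (single_hom_shift_eq_zero M i₀ n hn hbelow f)

/-- Some regular sequence in `I` has length computing the first nonvanishing `Ext(A/I, M)`. -/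
lemma exists_isRegSeq_isLeast_extSupport [IsNoetherianRing A] [IsLocalRing A]
    (hI : I ≤ IsLocalRing.maximalIdeal A) (i₀ : ℤ)
    (hMfg : ∀ i : ℤ, Module.Finite A (M.homology i)) (hinf : ¬ IsZero (M.homology i₀))
    (hbelow : ∀ i < i₀, IsZero (M.homology i)) :
    ∃ xs : List A, (∀ x ∈ xs, x ∈ I) ∧ IsRegSeq A M xs ∧
      IsLeast (extSupport I M) (i₀ + xs.length) := by
  induction hJ : CochainComplex.nilIdeal M using WellFoundedGT.induction generalizing M with
  | ind J ih =>
    subst hJ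
    have := hMfg i₀
    by_cases h : ∃ x ∈ I, IsSMulRegular (M.homology i₀) x
    · obtain ⟨x, hx, hreg⟩ := h
      obtain ⟨xs, hxs, hreg', hleast⟩ := ih _
        (lt_of_le_of_ne (CochainComplex.nilIdeal_le_mappingCone_smul M x) fun he ↦
          CochainComplex.not_mem_nilIdeal hinf hreg
            (he ▸ CochainComplex.mem_nilIdeal_mappingCone_smul M x))
        (CochainComplex.finite_homology_mappingCone_smul hMfg)
        (CochainComplex.not_isZero_homology_mappingCone_smul (hI hx) hinf)
        (CochainComplex.isZero_homology_mappingCone_smul hbelow hreg) rfl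
      refine ⟨x :: xs, List.forall_mem_cons.2 ⟨hx, hxs⟩,
        (CochainComplex.isRegSeq_cons hinf hbelow xs).2 ⟨hreg, hreg'⟩, ?_⟩
      rw [List.length_cons, Nat.cast_add, Nat.cast_one, ← add_assoc]
      exact isLeast_extSupport_add_one hx hleast
    · push Not at h
      refine ⟨[], by simp, trivial, ?_⟩
      simpa using isLeast_extSupport_of_forall_not_isSMulRegular hbelow h

end

/-- **Sequential depth equals depth minus inf (paper's Proposition 4.2, ring base).**
Let `(A, m)` be a commutative noetherian local ring, `M` a nonzero cohomologically
bounded-below complex of `A`-modules with finitely generated cohomology, `I ⊆ m` a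
proper ideal, and `i₀ = inf(M)`. Then the maximal length of an `M`-regular sequence of
elements of `I` is a finite number `d`, and `depth_A(I, M) = i₀ + d`, i.e.
`seq.depth_A(I, M) = depth_A(I, M) − inf(M)`. -/
theorem stmt_7
    (A : Type) [CommRing A] [IsNoetherianRing A] [IsLocalRing A]
    [HasDerivedCategory (ModuleCat A)]
    (M : CochainComplex (ModuleCat A) ℤ)
    (hMfg : ∀ i : ℤ, Module.Finite A (M.homology i))
    (i₀ : ℤ)
    (hinf : ¬ IsZero (M.homology i₀))
    (hbelow : ∀ i < i₀, IsZero (M.homology i))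
    (I : Ideal A) (hI : I ≤ IsLocalRing.maximalIdeal A) :
    ∃ d : ℕ,
      IsGreatest {k : ℕ | ∃ xs : List A, xs.length = k ∧ (∀ x ∈ xs, x ∈ I) ∧
        IsRegSeq A M xs} d ∧
      IsLeast {n : ℤ | ∃ f : (DerivedCategory.singleFunctor (ModuleCat A) 0).obj
          (ModuleCat.of A (A ⧸ I)) ⟶ (DerivedCategory.Q.obj M)⟦n⟧, f ≠ 0}
        (i₀ + (d : ℤ)) := by
  obtain ⟨xs, hxs, hreg, hleast⟩ := exists_isRegSeq_isLeast_extSupport hI i₀ hMfg hinf hbelow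
  refine ⟨xs.length, ⟨⟨xs, rfl, hxs, hreg⟩, ?_⟩, hleast⟩
  rintro k ⟨ys, rfl, hys, hregy⟩
  have := add_length_mem_lowerBounds_extSupport hI ys hys hMfg hinf hbelow hregy hleast.1
  lia
end
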